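/- Let (f,g,ρ) be a warped Berger solution of Ricci flow on S^1×S^3 defined on [0,T) satisfying Assumption C. Then for every sufficiently small δ > 0 and every Σ < ∞ there exist a constant C < ∞ and a time T_* < T such that for all t ∈ (T_*,T) and all ξ with |S(ξ,t)| ≤ Σ·√(T−t), one has (g(ξ,t) − f(ξ,t))/√(T−t) ≤ C·(T−t)^{1+δ}; that is, the scale-invariant eccentricity (T−t)^{−1/2}·|f−g| decays at the rate C·(T−t)^{1+δ} in the parabolic region around the neck. -/

import Mathlib

open Real Set Filter Topology

noncomputable section

/-- Partial derivative in the first (spatial, `ξ`) variable. -/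
def pd1 (φ : ℝ → ℝ → ℝ) (ξ t : ℝ) : ℝ := deriv (fun x => φ x t) ξ

/-- Partial derivative in the second (time) variable: `φ_t`. -/
def pdt (φ : ℝ → ℝ → ℝ) (ξ t : ℝ) : ℝ := deriv (fun τ => φ ξ τ) t

/-- Derivative with respect to arclength `s` (where `ds = ρ dξ`): `φ_s := ρ⁻¹ ∂_ξ φ`. -/
def Ds (ρ φ : ℝ → ℝ → ℝ) (ξ t : ℝ) : ℝ := pd1 φ ξ t / ρ ξ t

/-- Sectional curvature `κ₁₂ = κ₃₁ = f²/g⁴ − f_s g_s/(f g)`. -/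
def k12 (ρ f g : ℝ → ℝ → ℝ) (ξ t : ℝ) : ℝ :=
  (f ξ t) ^ 2 / (g ξ t) ^ 4 - Ds ρ f ξ t * Ds ρ g ξ t / (f ξ t * g ξ t)

/-- Sectional curvature `κ₃₁ = κ₁₂`. -/
def k31 (ρ f g : ℝ → ℝ → ℝ) (ξ t : ℝ) : ℝ :=
  (f ξ t) ^ 2 / (g ξ t) ^ 4 - Ds ρ f ξ t * Ds ρ g ξ t / (f ξ t * g ξ t)

/-- Sectional curvature `κ₂₃ = (4g² − 3f²)/g⁴ − g_s²/g²`. -/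
def k23 (ρ f g : ℝ → ℝ → ℝ) (ξ t : ℝ) : ℝ :=
  (4 * (g ξ t) ^ 2 - 3 * (f ξ t) ^ 2) / (g ξ t) ^ 4 - (Ds ρ g ξ t) ^ 2 / (g ξ t) ^ 2

/-- Sectional curvature `κ₀₁ = −f_ss/f`. -/
def k01 (ρ f : ℝ → ℝ → ℝ) (ξ t : ℝ) : ℝ := -(Ds ρ (Ds ρ f) ξ t) / f ξ t

/-- Sectional curvature `κ₀₂ = κ₀₃ = −g_ss/g`. -/
def k02 (ρ g : ℝ → ℝ → ℝ) (ξ t : ℝ) : ℝ := -(Ds ρ (Ds ρ g) ξ t) / g ξ t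

/-- Scalar curvature `R = κ₀₁ + 2κ₀₂ + 2κ₁₂ + κ₂₃`. -/
def scalR (ρ f g : ℝ → ℝ → ℝ) (ξ t : ℝ) : ℝ :=
  k01 ρ f ξ t + 2 * k02 ρ g ξ t + 2 * k12 ρ f g ξ t + k23 ρ f g ξ t

/-- `M(ξ,t) := min {f(ξ,t), g(ξ,t)}`. -/
def M (f g : ℝ → ℝ → ℝ) (ξ t : ℝ) : ℝ := min (f ξ t) (g ξ t)

/-- `M̌(t) := min_{ξ ∈ S¹} M(ξ,t)`. -/
def Mcheck (f g : ℝ → ℝ → ℝ) (t : ℝ) : ℝ := ⨅ ξ : ℝ, M f g ξ t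

/-- A warped Berger solution of Ricci flow on `S¹ × S³` with (finite) existence time `T`:
smooth positive `2π`-periodic-in-`ξ` functions `f, g, ρ` on `S¹ × [0,T)` satisfying
  `f_t = f_ss + 2 (g_s/g) f_s − 2 f³/g⁴`,
  `g_t = g_ss + (f_s/f + g_s/g) g_s + 2 (f² − 2g²)/g³`,
  `(log ρ)_t = f_ss/f + 2 g_ss/g`. -/
structure WarpedBerger (T : ℝ) (f g ρ : ℝ → ℝ → ℝ) : Prop where
  T_pos : 0 < T
  f_pos : ∀ ξ t : ℝ, 0 ≤ t → t < T → 0 < f ξ t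
  g_pos : ∀ ξ t : ℝ, 0 ≤ t → t < T → 0 < g ξ t
  ρ_pos : ∀ ξ t : ℝ, 0 ≤ t → t < T → 0 < ρ ξ t
  f_per : ∀ ξ t : ℝ, f (ξ + 2 * π) t = f ξ t
  g_per : ∀ ξ t : ℝ, g (ξ + 2 * π) t = g ξ t
  ρ_per : ∀ ξ t : ℝ, ρ (ξ + 2 * π) t = ρ ξ t
  smooth : ContDiffOn ℝ (⊤ : ℕ∞)
      (fun p : ℝ × ℝ => (f p.1 p.2, g p.1 p.2, ρ p.1 p.2)) (Set.univ ×ˢ Set.Ico 0 T)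
  eq_f : ∀ ξ t : ℝ, 0 < t → t < T →
    pdt f ξ t = Ds ρ (Ds ρ f) ξ t + 2 * (Ds ρ g ξ t / g ξ t) * Ds ρ f ξ t
      - 2 * (f ξ t) ^ 3 / (g ξ t) ^ 4
  eq_g : ∀ ξ t : ℝ, 0 < t → t < T →
    pdt g ξ t = Ds ρ (Ds ρ g) ξ t
      + (Ds ρ f ξ t / f ξ t + Ds ρ g ξ t / g ξ t) * Ds ρ g ξ t
      + 2 * ((f ξ t) ^ 2 - 2 * (g ξ t) ^ 2) / (g ξ t) ^ 3
  eq_ρ : ∀ ξ t : ℝ, 0 < t → t < T →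
    pdt (fun x τ => Real.log (ρ x τ)) ξ t
      = Ds ρ (Ds ρ f) ξ t / f ξ t + 2 * (Ds ρ (Ds ρ g) ξ t / g ξ t)

/-- The Ricci curvature blows up as `t ↗ T`:
`limsup_{t↗T} max_ξ (|κ₀₁+2κ₁₂| + |κ₀₁+2κ₀₂| + |κ₀₂+κ₁₂+κ₂₃|) = ∞`, where the three
displayed quantities are the diagonal components of the Ricci tensor. -/
def RicciBlowup (T : ℝ) (f g ρ : ℝ → ℝ → ℝ) : Prop :=
  ∀ K : ℝ, ∀ t₀ : ℝ, 0 ≤ t₀ → t₀ < T → ∃ ξ t : ℝ, t₀ < t ∧ t < T ∧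
    K < |k01 ρ f ξ t + 2 * k12 ρ f g ξ t| + |k01 ρ f ξ t + 2 * k02 ρ g ξ t|
        + |k02 ρ g ξ t + k12 ρ f g ξ t + k23 ρ f g ξ t|

/-- Assumption A: `f ≤ g` at `t = 0`; `(min_ξ R(ξ,0))·(max_ξ g(ξ,0)²) > −3`;
and the Ricci curvature blows up at the finite time `T`. -/
structure AssumptionA (T : ℝ) (f g ρ : ℝ → ℝ → ℝ) extends WarpedBerger T f g ρ : Prop where
  init_order : ∀ ξ : ℝ, f ξ 0 ≤ g ξ 0
  init_scalar : (⨅ ξ : ℝ, scalR ρ f g ξ 0) * (⨆ ξ : ℝ, (g ξ 0) ^ 2) > -3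
  ricci_blowup : RicciBlowup T f g ρ

/-- Assumption B: Assumption A and, in addition, at `t = 0` one has `f ≥ (1−ε)g` for some
`ε ∈ (0,1)` with `2(1−ε)⁵ + 4(1−ε)⁴ > 4/3`, and `|f_s| ≤ 1` at `t = 0`. -/
structure AssumptionB (T : ℝ) (f g ρ : ℝ → ℝ → ℝ) extends AssumptionA T f g ρ : Prop where
  init_pinched : ∃ ε : ℝ, 0 < ε ∧ ε < 1 ∧ 2 * (1 - ε) ^ 5 + 4 * (1 - ε) ^ 4 > 4 / 3 ∧
    ∀ ξ : ℝ, (1 - ε) * g ξ 0 ≤ f ξ 0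
  init_fs : ∀ ξ : ℝ, |Ds ρ f ξ 0| ≤ 1

/-- Assumption C: Assumption B and, in addition, the solution is reflection symmetric and,
for every `t` sufficiently close to `T`, the minimum `M̌(t)` of `M(·,t)` is attained at `ξ = 0`. -/
structure AssumptionC (T : ℝ) (f g ρ : ℝ → ℝ → ℝ) extends AssumptionB T f g ρ : Prop where
  refl_f : ∀ ξ t : ℝ, f (-ξ) t = f ξ t
  refl_g : ∀ ξ t : ℝ, g (-ξ) t = g ξ t
  refl_ρ : ∀ ξ t : ℝ, ρ (-ξ) t = ρ ξ t
  min_at_center : ∃ t₁ : ℝ, 0 ≤ t₁ ∧ t₁ < T ∧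
    ∀ t : ℝ, t₁ < t → t < T → M f g 0 t = Mcheck f g t

/-- Arclength from the neck at `ξ = 0`: `S(ξ,t) := ∫_0^ξ ρ(x,t) dx`. -/
def arcS (ρ : ℝ → ℝ → ℝ) (ξ t : ℝ) : ℝ := ∫ x in (0:ℝ)..ξ, ρ x t


/-! ### Infrastructure -/

def Sm (T : ℝ) (a : ℝ → ℝ → ℝ) : Prop :=
  ContDiffOn ℝ (⊤ : ℕ∞) (fun p : ℝ × ℝ => a p.1 p.2) (Set.univ ×ˢ Set.Ioo 0 T)

def Per (a : ℝ → ℝ → ℝ) : Prop := ∀ ξ t : ℝ, a (ξ + 2 * π) t = a ξ t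

structure J (T : ℝ) (ρ a as at' : ℝ → ℝ → ℝ) : Prop where
  sm : Sm T a
  per : Per a
  s : ∀ ξ t : ℝ, 0 < t → t < T → HasDerivAt (fun x => a x t) (ρ ξ t * as ξ t) ξ
  t : ∀ ξ t : ℝ, 0 < t → t < T → HasDerivAt (fun τ => a ξ τ) (at' ξ t) t

lemma isOpen_dom (T : ℝ) : IsOpen ((Set.univ : Set ℝ) ×ˢ Set.Ioo (0:ℝ) T) :=
  isOpen_univ.prod isOpen_Ioo

lemma Sm.contDiffAt {T : ℝ} {a : ℝ → ℝ → ℝ} (h : Sm T a) {ξ t : ℝ} (h0 : 0 < t) (h1 : t < T) :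
    ContDiffAt ℝ (⊤ : ℕ∞) (fun p : ℝ × ℝ => a p.1 p.2) (ξ, t) :=
  ContDiffOn.contDiffAt h ((isOpen_dom T).mem_nhds ⟨trivial, h0, h1⟩)

lemma Sm.diffAt {T : ℝ} {a : ℝ → ℝ → ℝ} (h : Sm T a) {ξ t : ℝ} (h0 : 0 < t) (h1 : t < T) :
    DifferentiableAt ℝ (fun p : ℝ × ℝ => a p.1 p.2) (ξ, t) :=
  (h.contDiffAt h0 h1).differentiableAt (by simp)

lemma Sm.hasDerivAt1 {T : ℝ} {a : ℝ → ℝ → ℝ} (h : Sm T a) {ξ t : ℝ} (h0 : 0 < t) (h1 : t < T) :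
    HasDerivAt (fun x => a x t) (fderiv ℝ (fun p : ℝ × ℝ => a p.1 p.2) (ξ, t) (1, 0)) ξ := by
  have h2 : HasDerivAt (fun x : ℝ => (x, t)) ((1:ℝ), (0:ℝ)) ξ :=
    (hasDerivAt_id ξ).prodMk (hasDerivAt_const ξ t)
  exact (h.diffAt h0 h1).hasFDerivAt.comp_hasDerivAt ξ h2

lemma Sm.hasDerivAt2 {T : ℝ} {a : ℝ → ℝ → ℝ} (h : Sm T a) {ξ t : ℝ} (h0 : 0 < t) (h1 : t < T) :
    HasDerivAt (fun τ => a ξ τ) (fderiv ℝ (fun p : ℝ × ℝ => a p.1 p.2) (ξ, t) (0, 1)) t := by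
  have h2 : HasDerivAt (fun x : ℝ => (ξ, x)) ((0:ℝ), (1:ℝ)) t :=
    (hasDerivAt_const t ξ).prodMk (hasDerivAt_id t)
  exact (h.diffAt h0 h1).hasFDerivAt.comp_hasDerivAt t h2

lemma Sm.pd1_eq {T : ℝ} {a : ℝ → ℝ → ℝ} (h : Sm T a) {ξ t : ℝ} (h0 : 0 < t) (h1 : t < T) :
    pd1 a ξ t = fderiv ℝ (fun p : ℝ × ℝ => a p.1 p.2) (ξ, t) (1, 0) :=
  (h.hasDerivAt1 h0 h1).deriv

lemma Sm.pdt_eq {T : ℝ} {a : ℝ → ℝ → ℝ} (h : Sm T a) {ξ t : ℝ} (h0 : 0 < t) (h1 : t < T) :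
    pdt a ξ t = fderiv ℝ (fun p : ℝ × ℝ => a p.1 p.2) (ξ, t) (0, 1) :=
  (h.hasDerivAt2 h0 h1).deriv

lemma Sm.fd {T : ℝ} {a : ℝ → ℝ → ℝ} (h : Sm T a) (e : ℝ × ℝ) :
    ContDiffOn ℝ (⊤ : ℕ∞) (fun q : ℝ × ℝ => fderiv ℝ (fun p : ℝ × ℝ => a p.1 p.2) q e)
      (Set.univ ×ˢ Set.Ioo 0 T) := by
  have h1 : ContDiffOn ℝ (⊤ : ℕ∞) (fderiv ℝ (fun p : ℝ × ℝ => a p.1 p.2))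
      (Set.univ ×ˢ Set.Ioo 0 T) := ContDiffOn.fderiv_of_isOpen h (isOpen_dom T) (by simp)
  exact h1.clm_apply contDiffOn_const

lemma Sm.pd1 {T : ℝ} {a : ℝ → ℝ → ℝ} (h : Sm T a) : Sm T (pd1 a) := by
  refine (h.fd (1, 0)).congr ?_
  rintro ⟨ξ, t⟩ ⟨-, h0, h1⟩
  exact h.pd1_eq h0 h1

lemma Sm.pdt {T : ℝ} {a : ℝ → ℝ → ℝ} (h : Sm T a) : Sm T (pdt a) := by
  refine (h.fd (0, 1)).congr ?_
  rintro ⟨ξ, t⟩ ⟨-, h0, h1⟩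
  exact h.pdt_eq h0 h1

lemma Sm.comm {T : ℝ} {a : ℝ → ℝ → ℝ} (h : Sm T a) {ξ t : ℝ} (h0 : 0 < t) (h1 : t < T) :
    _root_.pdt (_root_.pd1 a) ξ t = _root_.pd1 (_root_.pdt a) ξ t := by
  have hsym : IsSymmSndFDerivAt ℝ (fun p : ℝ × ℝ => a p.1 p.2) (ξ, t) :=
    (h.contDiffAt h0 h1).isSymmSndFDerivAt (by
      simp only [minSmoothness_of_isRCLikeNormedField]
      exact WithTop.coe_le_coe.mpr (le_top : (2:ℕ∞) ≤ ⊤))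
  have hd : DifferentiableAt ℝ (fderiv ℝ (fun p : ℝ × ℝ => a p.1 p.2)) (ξ, t) := by
    have h3 : ContDiffOn ℝ (⊤ : ℕ∞) (fderiv ℝ (fun p : ℝ × ℝ => a p.1 p.2))
      (Set.univ ×ˢ Set.Ioo 0 T) := ContDiffOn.fderiv_of_isOpen h (isOpen_dom T) (by simp)
    exact (h3.contDiffAt ((isOpen_dom T).mem_nhds ⟨trivial, h0, h1⟩)).differentiableAt (by simp)
  have key : ∀ e : ℝ × ℝ, ∀ b : ℝ → ℝ → ℝ,
      (∀ x τ, 0 < τ → τ < T → b x τ = fderiv ℝ (fun p : ℝ × ℝ => a p.1 p.2) (x, τ) e) →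
      ∀ e', fderiv ℝ (fun p : ℝ × ℝ => b p.1 p.2) (ξ, t) e' =
        fderiv ℝ (fderiv ℝ (fun p : ℝ × ℝ => a p.1 p.2)) (ξ, t) e' e := by
    intro e b hb e'
    have : (fun p : ℝ × ℝ => b p.1 p.2) =ᶠ[𝓝 (ξ, t)]
        (fun q => fderiv ℝ (fun p : ℝ × ℝ => a p.1 p.2) q e) := by
      filter_upwards [(isOpen_dom T).mem_nhds
        (show (ξ, t) ∈ (Set.univ : Set ℝ) ×ˢ Set.Ioo (0:ℝ) T from ⟨trivial, h0, h1⟩)] with q hq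
      exact hb q.1 q.2 hq.2.1 hq.2.2
    rw [this.fderiv_eq]
    have h5 := hd.hasFDerivAt.clm_apply (hasFDerivAt_const e (ξ, t))
    rw [h5.fderiv]
    simp
  rw [h.pd1.pdt_eq h0 h1, h.pdt.pd1_eq h0 h1,
    key (1, 0) _ (fun x τ a b => h.pd1_eq a b), key (0, 1) _ (fun x τ a b => h.pdt_eq a b)]
  exact hsym _ _

lemma Per.pd1 {a : ℝ → ℝ → ℝ} (h : Per a) : Per (pd1 a) := by
  intro ξ t
  unfold _root_.pd1
  rw [← deriv_comp_add_const]
  congr 1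
  funext x
  exact h x t

lemma Per.pdt {a : ℝ → ℝ → ℝ} (h : Per a) : Per (pdt a) := by
  intro ξ t
  unfold _root_.pdt
  congr 1
  funext x
  exact h ξ x

lemma Per.Ds {a ρ : ℝ → ℝ → ℝ} (h : Per a) (hρ : Per ρ) : Per (Ds ρ a) := by
  intro ξ t
  unfold _root_.Ds
  rw [h.pd1 ξ t, hρ ξ t]

lemma Sm.Ds {T : ℝ} {a ρ : ℝ → ℝ → ℝ} (h : Sm T a) (hρ : Sm T ρ)
    (hp : ∀ ξ t : ℝ, 0 < t → t < T → 0 < ρ ξ t) : Sm T (Ds ρ a) :=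
  ContDiffOn.div h.pd1 hρ (fun p hp' => (hp p.1 p.2 hp'.2.1 hp'.2.2).ne')

section
variable {T : ℝ} {ρ a as at' b bs bt : ℝ → ℝ → ℝ}

lemma J_of_Sm (h : Sm T a) (hper : Per a)
    (hp : ∀ ξ t : ℝ, 0 < t → t < T → 0 < ρ ξ t) : J T ρ a (Ds ρ a) (pdt a) := by
  refine ⟨h, hper, ?_, ?_⟩
  · intro ξ t h0 h1
    have := h.hasDerivAt1 (ξ := ξ) h0 h1
    rw [← h.pd1_eq h0 h1] at this
    convert this using 1
    unfold Ds
    have := (hp ξ t h0 h1).ne'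
    field_simp
  · intro ξ t h0 h1
    have := h.hasDerivAt2 (ξ := ξ) h0 h1
    rwa [← h.pdt_eq h0 h1] at this

lemma J.Ds_eq (h : J T ρ a as at') (hp : ∀ ξ t : ℝ, 0 < t → t < T → 0 < ρ ξ t)
    {ξ t : ℝ} (h0 : 0 < t) (h1 : t < T) : Ds ρ a ξ t = as ξ t := by
  unfold Ds pd1
  rw [(h.s ξ t h0 h1).deriv]
  have := (hp ξ t h0 h1).ne'
  field_simp

lemma J.pdt_eq (h : J T ρ a as at')
    {ξ t : ℝ} (h0 : 0 < t) (h1 : t < T) : pdt a ξ t = at' ξ t :=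
  (h.t ξ t h0 h1).deriv

lemma J.congr {as2 at2 : ℝ → ℝ → ℝ} (h : J T ρ a as at')
    (hs : ∀ ξ t : ℝ, 0 < t → t < T → as ξ t = as2 ξ t)
    (ht : ∀ ξ t : ℝ, 0 < t → t < T → at' ξ t = at2 ξ t) : J T ρ a as2 at2 := by
  refine ⟨h.sm, h.per, ?_, ?_⟩
  · intro ξ t h0 h1
    rw [← hs ξ t h0 h1]; exact h.s ξ t h0 h1
  · intro ξ t h0 h1
    rw [← ht ξ t h0 h1]; exact h.t ξ t h0 h1

lemma J.add (h : J T ρ a as at') (h' : J T ρ b bs bt) :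
    J T ρ (fun x t => a x t + b x t) (fun x t => as x t + bs x t) (fun x t => at' x t + bt x t) := by
  refine ⟨ContDiffOn.add h.sm h'.sm, fun ξ t => by simp [h.per ξ t, h'.per ξ t], ?_, ?_⟩
  · intro ξ t h0 h1
    exact ((h.s ξ t h0 h1).add (h'.s ξ t h0 h1)).congr_deriv (by ring)
  · intro ξ t h0 h1
    exact (h.t ξ t h0 h1).add (h'.t ξ t h0 h1)

lemma J.mul (h : J T ρ a as at') (h' : J T ρ b bs bt) :
    J T ρ (fun x t => a x t * b x t) (fun x t => as x t * b x t + a x t * bs x t)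
      (fun x t => at' x t * b x t + a x t * bt x t) := by
  refine ⟨ContDiffOn.mul h.sm h'.sm, fun ξ t => by simp [h.per ξ t, h'.per ξ t], ?_, ?_⟩
  · intro ξ t h0 h1
    exact ((h.s ξ t h0 h1).mul (h'.s ξ t h0 h1)).congr_deriv (by ring)
  · intro ξ t h0 h1
    exact (h.t ξ t h0 h1).mul (h'.t ξ t h0 h1)

lemma J_const (c : ℝ) : J T ρ (fun _ _ => c) (fun _ _ => 0) (fun _ _ => 0) := by
  refine ⟨contDiffOn_const, fun ξ t => rfl, ?_, ?_⟩
  · intro ξ t h0 h1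
    simpa using hasDerivAt_const ξ c
  · intro ξ t h0 h1
    exact hasDerivAt_const t c

lemma J_time : J T ρ (fun _ t => t) (fun _ _ => 0) (fun _ _ => 1) := by
  refine ⟨contDiff_snd.contDiffOn, fun ξ t => rfl, ?_, ?_⟩
  · intro ξ t h0 h1
    simpa using hasDerivAt_const ξ t
  · intro ξ t h0 h1
    exact hasDerivAt_id t

lemma J.cmul (h : J T ρ a as at') (c : ℝ) :
    J T ρ (fun x t => c * a x t) (fun x t => c * as x t) (fun x t => c * at' x t) := by
  refine (((J_const c).mul h).congr ?_ ?_) <;> intros <;> ring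

lemma J.exp (h : J T ρ a as at') :
    J T ρ (fun x t => Real.exp (a x t)) (fun x t => as x t * Real.exp (a x t))
      (fun x t => at' x t * Real.exp (a x t)) := by
  refine ⟨ContDiffOn.exp h.sm, fun ξ t => by simp [h.per ξ t], ?_, ?_⟩
  · intro ξ t h0 h1
    convert (h.s ξ t h0 h1).exp using 1
    ring
  · intro ξ t h0 h1
    convert (h.t ξ t h0 h1).exp using 1
    ring

lemma J.log (h : J T ρ a as at') (hpos : ∀ ξ t : ℝ, 0 < t → t < T → 0 < a ξ t) :
    J T ρ (fun x t => Real.log (a x t)) (fun x t => as x t / a x t)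
      (fun x t => at' x t / a x t) := by
  refine ⟨ContDiffOn.log h.sm (fun p hp' => (hpos p.1 p.2 hp'.2.1 hp'.2.2).ne'),
    fun ξ t => by simp [h.per ξ t], ?_, ?_⟩
  · intro ξ t h0 h1
    convert (h.s ξ t h0 h1).log (hpos ξ t h0 h1).ne' using 1
    ring
  · intro ξ t h0 h1
    exact (h.t ξ t h0 h1).log (hpos ξ t h0 h1).ne'

/-- Commutator of `∂_t` and `∂_s`. -/
lemma J.comm {L ats att ass ast ρs ρt : ℝ → ℝ → ℝ} (hρ : J T ρ ρ ρs ρt)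
    (hp : ∀ ξ t : ℝ, 0 < t → t < T → 0 < ρ ξ t)
    (hL : ∀ ξ t : ℝ, 0 < t → t < T → ρt ξ t = L ξ t * ρ ξ t)
    (h : J T ρ a as at') (hs : J T ρ as ass ast) (ht : J T ρ at' ats att) :
    J T ρ as ass (fun x t => ats x t - L x t * as x t) := by
  refine hs.congr (fun _ _ _ _ => rfl) ?_
  intro ξ t h0 h1
  have e1 : _root_.pdt (pd1 a) ξ t = ρt ξ t * as ξ t + ρ ξ t * ast ξ t := by
    have h2 := (hρ.t ξ t h0 h1).mul (hs.t ξ t h0 h1)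
    have h3 : (fun τ => pd1 a ξ τ) =ᶠ[𝓝 t] (fun τ => ρ ξ τ * as ξ τ) := by
      filter_upwards [isOpen_Ioo.mem_nhds (⟨h0, h1⟩ : t ∈ Ioo 0 T)] with τ hτ
      exact (h.s ξ τ hτ.1 hτ.2).deriv
    exact (h2.congr_of_eventuallyEq h3).deriv
  have e2 : pd1 (_root_.pdt a) ξ t = ρ ξ t * ats ξ t := by
    have h3 : (fun x => _root_.pdt a x t) = (fun x => at' x t) := by
      funext x
      exact (h.t x t h0 h1).deriv
    unfold pd1
    rw [h3]
    exact (ht.s ξ t h0 h1).deriv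
  have e3 := h.sm.comm (ξ := ξ) h0 h1
  rw [e1, e2, hL ξ t h0 h1] at e3
  have := hp ξ t h0 h1
  have h5 : ρ ξ t * ast ξ t = ρ ξ t * (ats ξ t - L ξ t * as ξ t) := by linear_combination e3
  exact mul_left_cancel₀ this.ne' h5

lemma Sm.contOn (h : Sm T a) {t0 : ℝ} (h0 : 0 < t0) :
    ContinuousOn (fun p : ℝ × ℝ => a p.1 p.2) (Set.univ ×ˢ Set.Ico t0 T) :=
  (ContDiffOn.continuousOn h).mono (fun p hp => ⟨trivial, lt_of_lt_of_le h0 hp.2.1, hp.2.2⟩)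

lemma Per.exists_rep (h : Per a) (ξ : ℝ) : ∃ η ∈ Set.Icc (0:ℝ) (2 * π), ∀ t, a ξ t = a η t := by
  have hp : Function.Periodic (fun x => a x) (2 * π) := fun x => funext (fun t => h x t)
  obtain ⟨η, hη, he⟩ := hp.exists_mem_Ico₀ (by positivity) ξ
  exact ⟨η, Ico_subset_Icc_self hη, fun t => congrFun he t⟩

lemma bdd_at (h : Sm T a) (hper : Per a) {t0 : ℝ} (h0 : 0 < t0) (h1 : t0 < T) :
    ∃ C : ℝ, 0 < C ∧ ∀ ξ, |a ξ t0| ≤ C := by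
  have hc : ContinuousOn (fun x => a x t0) (Set.Icc (0:ℝ) (2 * π)) := by
    have := h.contOn h0
    exact this.comp (f := fun x : ℝ => (x, t0)) (by fun_prop)
      (fun x _ => ⟨trivial, le_refl _, h1⟩)
  obtain ⟨C, hC⟩ := isCompact_Icc.exists_bound_of_continuousOn hc
  refine ⟨max C 1, by positivity, fun ξ => ?_⟩
  obtain ⟨η, hη, he⟩ := hper.exists_rep ξ
  rw [he]
  exact le_trans (hC η hη) (le_max_left _ _)

/-- Parabolic maximum principle, continuous version. -/
lemma max_principle0 {G : ℝ → ℝ → ℝ} {t0 K : ℝ} (hper : Per G)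
    (hc : ContinuousOn (fun p : ℝ × ℝ => G p.1 p.2) (Set.univ ×ˢ Set.Ico t0 T))
    (hinit : ∀ ξ, G ξ t0 ≤ 0)
    (h : ∀ ξ t, t0 < t → t < T → 0 < G ξ t → (∀ η, G η t ≤ G ξ t) →
      ∃ D, HasDerivAt (fun τ => G ξ τ) D t ∧ D ≤ K * G ξ t) :
    ∀ ξ t, t0 ≤ t → t < T → G ξ t ≤ 0 := by
  intro ξ1 t1 ht0 ht1
  by_contra hcon
  push Not at hcon
  set H : ℝ × ℝ → ℝ := fun p => Real.exp (-(K + 1) * p.2) * G p.1 p.2 with hH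
  have hHc : ContinuousOn H (Set.Icc (0:ℝ) (2 * π) ×ˢ Set.Icc t0 t1) := by
    refine ContinuousOn.mul (by fun_prop) (hc.mono ?_)
    rintro p ⟨-, hp⟩
    exact ⟨trivial, hp.1, lt_of_le_of_lt hp.2 ht1⟩
  obtain ⟨ζ, hζ, hζe⟩ := hper.exists_rep ξ1
  have hne : (Set.Icc (0:ℝ) (2 * π) ×ˢ Set.Icc t0 t1).Nonempty := ⟨(ζ, t1), hζ, ht0, le_refl _⟩
  obtain ⟨⟨x, t⟩, ⟨hx, ht⟩, hmax⟩ := (isCompact_Icc.prod isCompact_Icc).exists_isMaxOn hne hHc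
  have hmax' : ∀ η τ, t0 ≤ τ → τ ≤ t1 → H (η, τ) ≤ H (x, t) := by
    intro η τ h1 h2
    obtain ⟨η', hη', he⟩ := hper.exists_rep η
    have := hmax (show (η', τ) ∈ _ from ⟨hη', h1, h2⟩)
    simpa [hH, he] using this
  have hpos : 0 < H (x, t) := by
    refine lt_of_lt_of_le ?_ (hmax' ξ1 t1 ht0 le_rfl)
    simp only [hH]
    positivity
  have hGpos : 0 < G x t := by
    by_contra hn
    push Not at hn
    have : H (x, t) ≤ 0 := mul_nonpos_of_nonneg_of_nonpos (Real.exp_pos _).le hn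
    linarith
  have htt : t0 < t := by
    rcases eq_or_lt_of_le ht.1 with he | hl
    · exfalso
      simp only at he
      rw [← he] at hGpos
      exact absurd (hinit x) (not_le.mpr hGpos)
    · exact hl
  have htT : t < T := lt_of_le_of_lt ht.2 ht1
  obtain ⟨D, hD, hDle⟩ := h x t htt htT hGpos (by
    intro η
    have := hmax' η t ht.1 ht.2
    simp only [hH] at this
    exact le_of_mul_le_mul_left this (Real.exp_pos _))
  have hHd : HasDerivAt (fun τ => H (x, τ))
      (Real.exp (-(K + 1) * t) * (D - (K + 1) * G x t)) t := by
    have h1 : HasDerivAt (fun τ : ℝ => Real.exp (-(K + 1) * τ))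
        (Real.exp (-(K + 1) * t) * (-(K + 1) * 1)) t :=
      ((hasDerivAt_id t).const_mul (-(K + 1))).exp
    exact (h1.mul hD).congr_deriv (by ring)
  have hneg : Real.exp (-(K + 1) * t) * (D - (K + 1) * G x t) < 0 := by
    apply mul_neg_of_pos_of_neg (Real.exp_pos _)
    nlinarith
  -- values just before t are larger
  have hev := (hasDerivAt_iff_tendsto_slope.mp hHd).eventually (gt_mem_nhds hneg)
  have hev2 : ∀ᶠ τ in 𝓝[<] t, slope (fun τ => H (x, τ)) t τ < 0 :=
    hev.filter_mono (nhdsWithin_mono _ (fun y hy => ne_of_lt hy))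
  have hev3 : ∀ᶠ τ in 𝓝[<] t, τ ∈ Set.Ioo t0 t := Ioo_mem_nhdsLT htt
  obtain ⟨τ, hτ1, hτ2⟩ := (hev2.and hev3).exists
  have h5 := hmax' x τ hτ2.1.le (hτ2.2.le.trans ht.2)
  rw [slope_def_field] at hτ1
  have : 0 ≤ (H (x, τ) - H (x, t)) / (τ - t) :=
    div_nonneg_of_nonpos (by linarith) (by linarith [hτ2.2])
  linarith

lemma max_crit {Gs Gt Gss Gst G : ℝ → ℝ → ℝ} (hp : ∀ ξ t : ℝ, 0 < t → t < T → 0 < ρ ξ t)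
    (hG : J T ρ G Gs Gt) (hGs : J T ρ Gs Gss Gst) {ξ t : ℝ} (h0 : 0 < t) (h1 : t < T)
    (hm : ∀ η, G η t ≤ G ξ t) : Gs ξ t = 0 ∧ Gss ξ t ≤ 0 := by
  have hρ := hp ξ t h0 h1
  have hz : Gs ξ t = 0 := by
    have hl : IsLocalMax (fun x => G x t) ξ := Filter.Eventually.of_forall hm
    have := hl.hasDerivAt_eq_zero (hG.s ξ t h0 h1)
    rcases mul_eq_zero.mp this with h | h
    · exact absurd h hρ.ne'
    · exact h
  refine ⟨hz, ?_⟩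
  by_contra hn
  push Not at hn
  have hd := hGs.s ξ t h0 h1
  have hpos : 0 < ρ ξ t * Gss ξ t := mul_pos hρ hn
  have hev := (hasDerivAt_iff_tendsto_slope.mp hd).eventually (lt_mem_nhds hpos)
  have hev2 : ∀ᶠ y in 𝓝[>] ξ, 0 < slope (fun x => Gs x t) ξ y :=
    hev.filter_mono (nhdsWithin_mono _ (fun y hy => ne_of_gt hy))
  obtain ⟨z, hz1, hz2⟩ := (mem_nhdsGT_iff_exists_Ioo_subset).mp hev2
  have hz1' : ξ < z := hz1
  have hmono : StrictMonoOn (fun x => G x t) (Set.Icc ξ ((ξ + z) / 2)) := by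
    refine strictMonoOn_of_deriv_pos (convex_Icc _ _) ?_ ?_
    · intro x _
      exact (hG.s x t h0 h1).continuousAt.continuousWithinAt
    · intro x hx
      rw [interior_Icc] at hx
      rw [(hG.s x t h0 h1).deriv]
      have h5 : 0 < slope (fun x => Gs x t) ξ x := hz2 ⟨hx.1, by linarith [hx.2]⟩
      rw [slope_def_field, hz, sub_zero] at h5
      have h6 : 0 < Gs x t := by
        by_contra hh
        push Not at hh
        have := div_nonpos_of_nonpos_of_nonneg hh (by linarith [hx.1] : 0 ≤ x - ξ)
        linarith
      exact mul_pos (hp x t h0 h1) h6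
  have := hmono (left_mem_Icc.mpr (by linarith)) (right_mem_Icc.mpr (by linarith))
    (by linarith : ξ < (ξ + z) / 2)
  exact absurd (hm ((ξ + z) / 2)) (not_le.mpr this)

/-- Parabolic maximum principle. -/
lemma max_principle {G Gs Gt Gss Gst : ℝ → ℝ → ℝ} {t0 : ℝ} (K : ℝ)
    (hp : ∀ ξ t : ℝ, 0 < t → t < T → 0 < ρ ξ t)
    (hG : J T ρ G Gs Gt) (hGs : J T ρ Gs Gss Gst) (h0 : 0 < t0)
    (hinit : ∀ ξ, G ξ t0 ≤ 0)
    (h : ∀ ξ t, t0 < t → t < T → 0 < G ξ t → Gs ξ t = 0 → Gss ξ t ≤ 0 → Gt ξ t ≤ K * G ξ t) :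
    ∀ ξ t, t0 ≤ t → t < T → G ξ t ≤ 0 := by
  refine max_principle0 (K := K) hG.per (hG.sm.contOn h0) hinit ?_
  intro ξ t ht hT hpos hm
  obtain ⟨h2, h3⟩ := max_crit hp hG hGs (h0.trans ht) hT hm
  exact ⟨Gt ξ t, hG.t ξ t (h0.trans ht) hT, h ξ t ht hT hpos h2 h3⟩

end

lemma J.of_eq {T : ℝ} {ρ a as at' a2 as2 at2 : ℝ → ℝ → ℝ} (h : J T ρ a as at')
    (ha : ∀ ξ t : ℝ, a ξ t = a2 ξ t)
    (hs : ∀ ξ t : ℝ, as ξ t = as2 ξ t)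
    (ht : ∀ ξ t : ℝ, at' ξ t = at2 ξ t) : J T ρ a2 as2 at2 := by
  have e1 : a = a2 := funext fun x => funext fun t => ha x t
  have e2 : as = as2 := funext fun x => funext fun t => hs x t
  have e3 : at' = at2 := funext fun x => funext fun t => ht x t
  rw [← e1, ← e2, ← e3]; exact h

lemma J.exists_max {T : ℝ} {ρ a as at' : ℝ → ℝ → ℝ} (h : J T ρ a as at')
    (hp : ∀ ξ t : ℝ, 0 < t → t < T → 0 < ρ ξ t) {t : ℝ} (h0 : 0 < t)
    (h1 : t < T) : ∃ ξ, (∀ η, a η t ≤ a ξ t) ∧ as ξ t = 0 := by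
  have hc : ContinuousOn (fun x => a x t) (Set.Icc (0:ℝ) (2 * π)) := fun x _ =>
    (h.s x t h0 h1).continuousAt.continuousWithinAt
  obtain ⟨x, hx, hm⟩ := isCompact_Icc.exists_isMaxOn (Set.nonempty_Icc.mpr (by positivity)) hc
  have hm' : ∀ η, a η t ≤ a x t := by
    intro η
    obtain ⟨η', hη', he⟩ := h.per.exists_rep η
    rw [he]
    exact hm hη'
  refine ⟨x, hm', ?_⟩
  have hl : IsLocalMax (fun x => a x t) x := Filter.Eventually.of_forall hm'
  have := hl.hasDerivAt_eq_zero (h.s x t h0 h1)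
  rcases mul_eq_zero.mp this with h' | h'
  · exact absurd h' (hp x t h0 h1).ne'
  · exact h'

/-- The system in logarithmic variables `u = log f`, `v = log g`. -/
structure Sys (T : ℝ) (ρ u v p c p1 c1 p2 c2 p3 c3 q y : ℝ → ℝ → ℝ) : Prop where
  T_pos : 0 < T
  ρ_pos : ∀ ξ t : ℝ, 0 < t → t < T → 0 < ρ ξ t
  q_eq : ∀ ξ t, q ξ t = Real.exp (2 * u ξ t - 4 * v ξ t)
  y_eq : ∀ ξ t, y ξ t = Real.exp (-2 * v ξ t)
  hu : J T ρ u p (fun x t => p1 x t + (p x t + 2 * c x t) * p x t - 2 * q x t)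
  hv : J T ρ v c (fun x t => c1 x t + (p x t + 2 * c x t) * c x t + 2 * q x t - 4 * y x t)
  hp : J T ρ p p1 (fun x t => p2 x t + (p x t + 2 * c x t) * p1 x t
    - (p x t ^ 2 + 2 * c x t ^ 2) * p x t - 2 * ((2 * p x t - 4 * c x t) * q x t))
  hc : J T ρ c c1 (fun x t => c2 x t + (p x t + 2 * c x t) * c1 x t
    - (p x t ^ 2 + 2 * c x t ^ 2) * c x t + 2 * ((2 * p x t - 4 * c x t) * q x t)
    + 8 * (c x t * y x t))
  hp1 : J T ρ p1 p2 (fun x t => p3 x t + (p x t + 2 * c x t) * p2 x t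
    - 2 * (p x t ^ 2 + 2 * c x t ^ 2) * p1 x t
    - (2 * p x t * p1 x t + 4 * c x t * c1 x t) * p x t
    - 2 * ((2 * p1 x t - 4 * c1 x t) + (2 * p x t - 4 * c x t) ^ 2) * q x t)
  hc1 : J T ρ c1 c2 (fun x t => c3 x t + (p x t + 2 * c x t) * c2 x t
    - 2 * (p x t ^ 2 + 2 * c x t ^ 2) * c1 x t
    - (2 * p x t * p1 x t + 4 * c x t * c1 x t) * c x t
    + 2 * ((2 * p1 x t - 4 * c1 x t) + (2 * p x t - 4 * c x t) ^ 2) * q x t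
    + 8 * (c1 x t - 2 * c x t ^ 2) * y x t)
  hp2 : J T ρ p2 p3 (pdt p2)
  hc2 : J T ρ c2 c3 (pdt c2)
  hq : J T ρ q (fun x t => (2 * p x t - 4 * c x t) * q x t)
    (fun x t => (2 * (p1 x t + (p x t + 2 * c x t) * p x t - 2 * q x t)
      - 4 * (c1 x t + (p x t + 2 * c x t) * c x t + 2 * q x t - 4 * y x t)) * q x t)
  hy : J T ρ y (fun x t => -2 * c x t * y x t)
    (fun x t => -2 * (c1 x t + (p x t + 2 * c x t) * c x t + 2 * q x t - 4 * y x t) * y x t)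
  ord : ∀ ξ t, 0 < t → t < T → u ξ t ≤ v ξ t

lemma J.of_eqs {T : ℝ} {ρ a as at' a2 as2 : ℝ → ℝ → ℝ} (h : J T ρ a as at')
    (ha : ∀ ξ t : ℝ, a ξ t = a2 ξ t)
    (hs : ∀ ξ t : ℝ, as ξ t = as2 ξ t) : J T ρ a2 as2 (pdt a2) := by
  have e1 : a = a2 := funext fun x => funext fun t => ha x t
  have e2 : as = as2 := funext fun x => funext fun t => hs x t
  rw [← e1, ← e2]
  exact h.congr (fun _ _ _ _ => rfl) (fun _ _ h0 h1 => (h.pdt_eq h0 h1).symm)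

/-- A jet whose time derivative is not specified. -/
abbrev JJ (T : ℝ) (ρ a as : ℝ → ℝ → ℝ) : Prop := J T ρ a as (pdt a)

namespace Sys
variable {T : ℝ} {ρ u v p c p1 c1 p2 c2 p3 c3 q y : ℝ → ℝ → ℝ}

lemma q_pos (h : Sys T ρ u v p c p1 c1 p2 c2 p3 c3 q y) (ξ t : ℝ) : 0 < q ξ t := by
  rw [h.q_eq]; exact Real.exp_pos _

lemma y_pos (h : Sys T ρ u v p c p1 c1 p2 c2 p3 c3 q y) (ξ t : ℝ) : 0 < y ξ t := by
  rw [h.y_eq]; exact Real.exp_pos _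

lemma q_le_y (h : Sys T ρ u v p c p1 c1 p2 c2 p3 c3 q y) (ξ t : ℝ) (h0 : 0 < t) (h1 : t < T) :
    q ξ t ≤ y ξ t := by
  rw [h.q_eq, h.y_eq]
  exact Real.exp_le_exp.mpr (by linarith [h.ord ξ t h0 h1])

lemma R_lower (h : Sys T ρ u v p c p1 c1 p2 c2 p3 c3 q y) : ∃ C : ℝ, 0 < C ∧
    ∀ ξ t, T / 2 ≤ t → t < T →
      p1 ξ t + 2 * c1 ξ t + (p ξ t ^ 2 + 2 * p ξ t * c ξ t + 3 * c ξ t ^ 2)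
        ≤ 4 * y ξ t - q ξ t + C := by
  have hT := h.T_pos
  have J1 : ∀ C : ℝ, J T ρ (fun x t => p1 x t + 2 * c1 x t
        + (p x t ^ 2 + 2 * p x t * c x t + 3 * c x t ^ 2) - 4 * y x t + q x t + C)
      (fun x t => p2 x t + 2 * c2 x t + (2 * p x t * p1 x t + 2 * (p1 x t * c x t + p x t * c1 x t)
        + 6 * c x t * c1 x t) + 8 * (c x t * y x t) + 2 * (p x t * q x t) - 4 * (c x t * q x t))
      (fun x t => (p3 x t + 2 * c3 x t + (2 * p1 x t ^ 2 + 2 * p x t * p2 x t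
        + 2 * (p2 x t * c x t + 2 * p1 x t * c1 x t + p x t * c2 x t)
        + 6 * c1 x t ^ 2 + 6 * c x t * c2 x t) + 8 * (c1 x t * y x t - 2 * c x t ^ 2 * y x t)
        + 2 * p1 x t * q x t - 4 * c1 x t * q x t + (2 * p x t - 4 * c x t) ^ 2 * q x t)
        + (p x t + 2 * c x t) * (p2 x t + 2 * c2 x t + (2 * p x t * p1 x t + 2 * (p1 x t * c x t + p x t * c1 x t)
        + 6 * c x t * c1 x t) + 8 * (c x t * y x t) + 2 * (p x t * q x t) - 4 * (c x t * q x t))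
        - ((p1 x t + p x t ^ 2 + 2 * (c1 x t + c x t ^ 2)) ^ 2
        + (2 * (q x t - p x t * c x t) - p1 x t - p x t ^ 2) ^ 2
        + 2 * (4 * y x t - 3 * q x t - c x t ^ 2 + q x t - p x t * c x t - c1 x t - c x t ^ 2) ^ 2)) := by
    intro C
    refine ((((((h.hp1.add (h.hc1.cmul 2)).add (((h.hp.mul h.hp).add ((h.hp.mul h.hc).cmul 2)).add
      ((h.hc.mul h.hc).cmul 3))).add (h.hy.cmul (-4))).add h.hq).add (J_const C))).of_eq
      ?_ ?_ ?_ <;> intros <;> ring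
  have J2 : JJ T ρ (fun x t => p2 x t + 2 * c2 x t + (2 * p x t * p1 x t
        + 2 * (p1 x t * c x t + p x t * c1 x t)
        + 6 * c x t * c1 x t) + 8 * (c x t * y x t) + 2 * (p x t * q x t) - 4 * (c x t * q x t))
      (fun x t => p3 x t + 2 * c3 x t + (2 * p1 x t ^ 2 + 2 * p x t * p2 x t
        + 2 * (p2 x t * c x t + 2 * p1 x t * c1 x t + p x t * c2 x t)
        + 6 * c1 x t ^ 2 + 6 * c x t * c2 x t) + 8 * (c1 x t * y x t - 2 * c x t ^ 2 * y x t)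
        + 2 * p1 x t * q x t - 4 * c1 x t * q x t + (2 * p x t - 4 * c x t) ^ 2 * q x t) := by
    refine (((((h.hp2.add (h.hc2.cmul 2)).add ((((h.hp.mul h.hp1).cmul 2).add
      (((h.hp1.mul h.hc).add (h.hp.mul h.hc1)).cmul 2)).add ((h.hc.mul h.hc1).cmul 6))).add
      ((h.hc.mul h.hy).cmul 8)).add ((h.hp.mul h.hq).cmul 2)).add ((h.hc.mul h.hq).cmul (-4))).of_eqs
      ?_ ?_ <;> intros <;> ring
  obtain ⟨C, hC, hb⟩ := bdd_at (J1 0).sm (J1 0).per (by linarith : 0 < T / 2) (by linarith)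
  refine ⟨C, hC, ?_⟩
  have := max_principle 0 h.ρ_pos (J1 (-C)) J2 (by linarith : 0 < T / 2) ?_ ?_
  · intro ξ t h0 h1
    have := this ξ t h0 h1
    linarith
  · intro ξ
    have := (abs_le.mp (hb ξ)).2
    linarith
  · intro ξ t h0 h1 hG hs hss
    have key : ∀ P C0 P1 C1 P2 C2 P3 C3 Q Y A B : ℝ, A = 0 → B ≤ 0 →
      A = P2 + 2 * C2 + (2 * P * P1 + 2 * (P1 * C0 + P * C1)
        + 6 * C0 * C1) + 8 * (C0 * Y) + 2 * (P * Q) - 4 * (C0 * Q) →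
      B = P3 + 2 * C3 + (2 * P1 ^ 2 + 2 * P * P2
        + 2 * (P2 * C0 + 2 * P1 * C1 + P * C2)
        + 6 * C1 ^ 2 + 6 * C0 * C2) + 8 * (C1 * Y - 2 * C0 ^ 2 * Y)
        + 2 * P1 * Q - 4 * C1 * Q + (2 * P - 4 * C0) ^ 2 * Q →
      ∀ E, E = B + (P + 2 * C0) * A - ((P1 + P ^ 2 + 2 * (C1 + C0 ^ 2)) ^ 2
        + (2 * (Q - P * C0) - P1 - P ^ 2) ^ 2
        + 2 * (4 * Y - 3 * Q - C0 ^ 2 + Q - P * C0 - C1 - C0 ^ 2) ^ 2) → E ≤ 0 := by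
      intro P C0 P1 C1 P2 C2 P3 C3 Q Y A B hA hB _ _ E hE
      rw [hE, hA]
      nlinarith [sq_nonneg (P1 + P ^ 2 + 2 * (C1 + C0 ^ 2)), sq_nonneg (2 * (Q - P * C0) - P1 - P ^ 2),
        sq_nonneg (4 * Y - 3 * Q - C0 ^ 2 + Q - P * C0 - C1 - C0 ^ 2)]
    rw [zero_mul]
    refine key (p ξ t) (c ξ t) (p1 ξ t) (c1 ξ t) (p2 ξ t) (c2 ξ t) (p3 ξ t) (c3 ξ t) (q ξ t) (y ξ t)
      _ _ hs hss rfl rfl _ rfl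

lemma d_upper (h : Sys T ρ u v p c p1 c1 p2 c2 p3 c3 q y) : ∃ C : ℝ, 0 < C ∧
    ∀ ξ t, T / 2 ≤ t → t < T → v ξ t - u ξ t ≤ C := by
  have hT := h.T_pos
  have J1 : ∀ C : ℝ, J T ρ (fun x t => v x t - u x t + C) (fun x t => c x t - p x t)
      (fun x t => c1 x t - p1 x t + (p x t + 2 * c x t) * (c x t - p x t)
        - 4 * (y x t - q x t)) := by
    intro C
    refine ((h.hv.add (h.hu.cmul (-1))).add (J_const C)).of_eq ?_ ?_ ?_ <;> intros <;> ring
  have J2 : JJ T ρ (fun x t => c x t - p x t) (fun x t => c1 x t - p1 x t) := by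
    refine (h.hc.add (h.hp.cmul (-1))).of_eqs ?_ ?_ <;> intros <;> ring
  obtain ⟨C, hC, hb⟩ := bdd_at (J1 0).sm (J1 0).per (by linarith : 0 < T / 2) (by linarith)
  refine ⟨C, hC, ?_⟩
  have := max_principle 0 h.ρ_pos (J1 (-C)) J2 (by linarith : 0 < T / 2) ?_ ?_
  · intro ξ t h0 h1
    have := this ξ t h0 h1
    linarith
  · intro ξ
    have := (abs_le.mp (hb ξ)).2
    linarith
  · intro ξ t h0 h1 hG hs hss
    have := h.q_le_y ξ t (by linarith) h1
    rw [hs]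
    linarith

lemma v_upper (h : Sys T ρ u v p c p1 c1 p2 c2 p3 c3 q y) : ∃ C : ℝ, 0 < C ∧
    ∀ ξ t, T / 2 ≤ t → t < T → v ξ t ≤ C := by
  have hT := h.T_pos
  have J1 : ∀ C : ℝ, J T ρ (fun x t => v x t + C) (fun x t => c x t)
      (fun x t => c1 x t + (p x t + 2 * c x t) * c x t + 2 * q x t - 4 * y x t) := by
    intro C
    refine (h.hv.add (J_const C)).of_eq (fun _ _ => rfl) ?_ ?_ <;> intros <;> ring
  obtain ⟨C, hC, hb⟩ := bdd_at (J1 0).sm (J1 0).per (by linarith : 0 < T / 2) (by linarith)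
  refine ⟨C, hC, ?_⟩
  have := max_principle 0 h.ρ_pos (J1 (-C)) h.hc (by linarith : 0 < T / 2) ?_ ?_
  · intro ξ t h0 h1
    have := this ξ t h0 h1
    linarith
  · intro ξ
    have := (abs_le.mp (hb ξ)).2
    linarith
  · intro ξ t h0 h1 hG hs hss
    have := h.q_le_y ξ t (by linarith) h1
    have := h.y_pos ξ t
    simp only [hs]
    linarith

/-- `F = ψ² = (f g²)^{2/3}` -/
def F (u v : ℝ → ℝ → ℝ) (ξ t : ℝ) : ℝ := Real.exp ((2 / 3) * (u ξ t + 2 * v ξ t))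

lemma F_pos (ξ t : ℝ) : 0 < F u v ξ t := Real.exp_pos _

lemma Fy (h : Sys T ρ u v p c p1 c1 p2 c2 p3 c3 q y) (ξ t : ℝ) :
    F u v ξ t * y ξ t = Real.exp (-(2 / 3) * (v ξ t - u ξ t)) := by
  rw [h.y_eq, F, ← Real.exp_add]; congr 1; ring

lemma Fq (h : Sys T ρ u v p c p1 c1 p2 c2 p3 c3 q y) (ξ t : ℝ) :
    F u v ξ t * q ξ t = Real.exp (-(2 / 3) * (v ξ t - u ξ t)) ^ 4 := by
  rw [h.q_eq, F, ← Real.exp_add, ← Real.exp_nat_mul]; congr 1; push_cast; ring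

lemma F4 (h : Sys T ρ u v p c p1 c1 p2 c2 p3 c3 q y) (ξ t : ℝ) :
    F u v ξ t * (4 * y ξ t - q ξ t) ≤ 3 := by
  have h1 := h.Fy ξ t
  have h2 := h.Fq ξ t
  set k := Real.exp (-(2 / 3) * (v ξ t - u ξ t))
  nlinarith [mul_nonneg (sq_nonneg (k - 1)) (by nlinarith [sq_nonneg (k + 1)] : 0 ≤ k ^ 2 + 2 * k + 3)]

lemma hF (h : Sys T ρ u v p c p1 c1 p2 c2 p3 c3 q y) :
    J T ρ (F u v) (fun x t => (2 / 3) * ((p x t + 2 * c x t) * F u v x t))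
      (fun x t => (2 / 3) * (p1 x t + 2 * c1 x t + (p x t + 2 * c x t) ^ 2
        - 8 * y x t + 2 * q x t) * F u v x t) := by
  refine (((h.hu.add (h.hv.cmul 2)).cmul (2 / 3)).exp).of_eq (fun _ _ => rfl) ?_ ?_ <;> intros <;>
    simp only [F] <;> ring

lemma slope_bd (h : Sys T ρ u v p c p1 c1 p2 c2 p3 c3 q y) : ∃ K : ℝ, 0 < K ∧
    ∀ t, T / 2 ≤ t → t < T → ∀ m, 0 ≤ m → (∀ ξ, m ≤ F u v ξ t) → ∀ ξ,
      (4 / 9) * (p ξ t + 2 * c ξ t) ^ 2 * F u v ξ t ^ 2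
        ≤ 4 * (F u v ξ t - m) + K * (F u v ξ t ^ 2 - m ^ 2) := by
  obtain ⟨C, hC, hR⟩ := h.R_lower
  have hT := h.T_pos
  refine ⟨C + 1, by linarith, ?_⟩
  intro t ht hT1 m hm hF ξ
  have J1 : JJ T ρ (fun x t => (4 / 9) * (p x t + 2 * c x t) ^ 2 * F u v x t ^ 2
      + (-4) * F u v x t + (-(C + 1)) * F u v x t ^ 2)
      (fun x t => (4 / 3) * ((p x t + 2 * c x t) * F u v x t)
        * ((2 / 3) * F u v x t * (p1 x t + 2 * c1 x t + (2 / 3) * (p x t + 2 * c x t) ^ 2)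
          - 2 - (C + 1) * F u v x t)) := by
    have a1 := (h.hp.add (h.hc.cmul 2)).mul h.hF
    refine ((((a1.mul a1).cmul (4 / 9)).add (h.hF.cmul (-4))).add
      ((h.hF.mul h.hF).cmul (-(C + 1)))).of_eqs ?_ ?_ <;> intros <;> ring
  obtain ⟨x, hx, hx0⟩ := J1.exists_max h.ρ_pos (by linarith : 0 < t) hT1
  have hFp : 0 < F u v x t := F_pos x t
  have h2 := hR x t ht hT1
  have h3 := h.F4 x t
  have hfac : (2 / 3) * F u v x t * (p1 x t + 2 * c1 x t + (2 / 3) * (p x t + 2 * c x t) ^ 2)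
          - 2 - (C + 1) * F u v x t < 0 := by
    have h4 : p1 x t + 2 * c1 x t + (2 / 3) * (p x t + 2 * c x t) ^ 2 ≤ 4 * y x t - q x t + C := by
      nlinarith [sq_nonneg (p x t - c x t)]
    have h5 := mul_le_mul_of_nonneg_left h4 hFp.le
    nlinarith [mul_pos hC hFp]
  have hz : p x t + 2 * c x t = 0 := by
    rcases mul_eq_zero.mp hx0 with h' | h'
    · have := (mul_eq_zero.mp h').resolve_left (by norm_num)
      exact (mul_eq_zero.mp this).resolve_right hFp.ne'
    · exact absurd h' hfac.ne
  have h6 := hx ξ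
  simp only [hz] at h6
  have h7 := hF x
  nlinarith [mul_nonneg (by linarith : 0 ≤ C + 1) (mul_nonneg (sub_nonneg.mpr h7)
    (by linarith : 0 ≤ F u v x t + m))]

lemma barrier (h : Sys T ρ u v p c p1 c1 p2 c2 p3 c3 q y) {P B A t0 : ℝ} (hP : 0 ≤ P) (hB : 0 ≤ B)
    (hA : 0 ≤ A) (ht0 : 0 < t0)
    (hinit : ∀ ξ, v ξ t0 - u ξ t0
      ≤ A * Real.exp (P / 3 * (u ξ t0 + 2 * v ξ t0) - B * (T - t0) / F u v ξ t0))
    (hcond : ∀ ξ t, t0 < t → t < T →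
      A * Real.exp (P / 3 * (u ξ t + 2 * v ξ t) - B * (T - t) / F u v ξ t) < v ξ t - u ξ t →
      ∃ l : ℝ, 0 ≤ l ∧ l * (v ξ t - u ξ t) ≤ 4 * (F u v ξ t * (y ξ t - q ξ t)) ∧
        -l ≤ B - 2 * (P + 2 * (B * (T - t) / F u v ξ t))
          - ((P + 2 * (B * (T - t) / F u v ξ t)) ^ 2 - 4 * (B * (T - t) / F u v ξ t))
            * ((p ξ t + 2 * c ξ t) ^ 2 / 9 * F u v ξ t)) :
    ∀ ξ t, t0 ≤ t → t < T → v ξ t - u ξ t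
      ≤ A * Real.exp (P / 3 * (u ξ t + 2 * v ξ t) - B * (T - t) / F u v ξ t) := by
  -- N = 1/F
  set N : ℝ → ℝ → ℝ := fun x t => Real.exp (-(2 / 3) * (u x t + 2 * v x t)) with hN
  have hNF : ∀ x t, (F u v x t)⁻¹ = N x t := by
    intro x t
    simp only [hN, F, ← Real.exp_neg]
    congr 1; ring
  simp only [div_eq_mul_inv _ (F u v _ _), hNF] at hinit hcond ⊢
  have jN : J T ρ N (fun x t => -(2 / 3) * (p x t + 2 * c x t) * N x t)
      (fun x t => -(2 / 3) * (p1 x t + 2 * c1 x t + (p x t + 2 * c x t) ^ 2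
        - 8 * y x t + 2 * q x t) * N x t) := by
    refine (((h.hu.add (h.hv.cmul 2)).cmul (-(2 / 3))).exp).of_eq (fun _ _ => rfl) ?_ ?_ <;> intros <;>
      simp only [hN] <;> ring
  have jth : J T ρ (fun x t => B * (T - t) * N x t)
      (fun x t => -(2 / 3) * (p x t + 2 * c x t) * (B * (T - t) * N x t))
      (fun x t => -(2 / 3) * (p1 x t + 2 * c1 x t + (p x t + 2 * c x t) ^ 2
        - 8 * y x t + 2 * q x t) * (B * (T - t) * N x t) - B * N x t) := by
    refine ((((J_const T).add (J_time.cmul (-1))).mul jN).cmul B).of_eq ?_ ?_ ?_ <;> intros <;> ring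
  set θ : ℝ → ℝ → ℝ := fun x t => B * (T - t) * N x t with hθ
  have jom : J T ρ (fun x t => P / 3 * (u x t + 2 * v x t) - θ x t)
      (fun x t => (P + 2 * θ x t) * (p x t + 2 * c x t) / 3)
      (fun x t => (P + 2 * θ x t) / 3 * (p1 x t + 2 * c1 x t + (p x t + 2 * c x t) ^ 2
        - 8 * y x t + 2 * q x t) + B * N x t) := by
    refine (((h.hu.add (h.hv.cmul 2)).cmul (P / 3)).add (jth.cmul (-1))).of_eq ?_ ?_ ?_ <;> intros <;>
      ring
  set W : ℝ → ℝ → ℝ := fun x t => Real.exp (P / 3 * (u x t + 2 * v x t) - θ x t) with hW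
  have jW : J T ρ W (fun x t => (P + 2 * θ x t) * (p x t + 2 * c x t) / 3 * W x t)
      (fun x t => ((P + 2 * θ x t) / 3 * (p1 x t + 2 * c1 x t + (p x t + 2 * c x t) ^ 2
        - 8 * y x t + 2 * q x t) + B * N x t) * W x t) := jom.exp
  have J1 : J T ρ (fun x t => v x t - u x t - A * W x t)
      (fun x t => c x t - p x t - A * ((P + 2 * θ x t) * (p x t + 2 * c x t) / 3 * W x t))
      (fun x t => c1 x t - p1 x t + (p x t + 2 * c x t) * (c x t - p x t)
        - 4 * (y x t - q x t)
        - A * (((P + 2 * θ x t) / 3 * (p1 x t + 2 * c1 x t + (p x t + 2 * c x t) ^ 2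
        - 8 * y x t + 2 * q x t) + B * N x t) * W x t)) := by
    refine ((h.hv.add (h.hu.cmul (-1))).add (jW.cmul (-A))).of_eq ?_ ?_ ?_ <;> intros <;> ring
  have J2 : JJ T ρ (fun x t => c x t - p x t - A * ((P + 2 * θ x t) * (p x t + 2 * c x t) / 3 * W x t))
      (fun x t => c1 x t - p1 x t - A * W x t * (
        ((P + 2 * θ x t) * (p x t + 2 * c x t) / 3) ^ 2
        + (P + 2 * θ x t) * (p1 x t + 2 * c1 x t) / 3
        - (4 / 9) * θ x t * (p x t + 2 * c x t) ^ 2)) := by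
    refine ((h.hc.add (h.hp.cmul (-1))).add (((((J_const P).add (jth.cmul 2)).mul
      (h.hp.add (h.hc.cmul 2))).mul jW).cmul (-A / 3))).of_eqs ?_ ?_ <;> intros <;>
      ring
  have := max_principle 0 h.ρ_pos J1 J2 ht0 ?_ ?_
  · intro ξ t h0 h1
    have := this ξ t h0 h1
    simp only [hW, hθ] at this
    linarith
  · intro ξ
    have := hinit ξ
    simp only [hW, hθ]
    linarith
  · intro ξ t h0 h1 hG hs hss
    obtain ⟨l, hl0, hl1, hl2⟩ := hcond ξ t h0 h1 (by
      simp only [hW, hθ] at hG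
      linarith)
    have hNp : 0 < N ξ t := Real.exp_pos _
    have hFp : 0 < F u v ξ t := F_pos ξ t
    have hFN : F u v ξ t * N ξ t = 1 := by rw [← hNF]; exact mul_inv_cancel₀ hFp.ne'
    have hWp : 0 < W ξ t := Real.exp_pos _
    have hθ0 : 0 ≤ θ ξ t := mul_nonneg (mul_nonneg hB (by linarith)) hNp.le
    have e : B * (T - t) * N ξ t = θ ξ t := rfl
    rw [e] at hl2
    have h4 := h.F4 ξ t
    have key : ∀ P0 C0 P1 C1 Q Y Ff n th w d G2 : ℝ, 0 < Ff → Ff * n = 1 → 0 ≤ th → 0 < w →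
        l * d ≤ 4 * (Ff * (Y - Q)) → Ff * (4 * Y - Q) ≤ 3 →
        -l ≤ B - 2 * (P + 2 * th) - ((P + 2 * th) ^ 2 - 4 * th) * ((P0 + 2 * C0) ^ 2 / 9 * Ff) →
        0 < d - A * w →
        C0 - P0 - A * ((P + 2 * th) * (P0 + 2 * C0) / 3 * w) = 0 →
        G2 ≤ 0 → G2 = C1 - P1 - A * w * (((P + 2 * th) * (P0 + 2 * C0) / 3) ^ 2
          + (P + 2 * th) * (P1 + 2 * C1) / 3 - (4 / 9) * th * (P0 + 2 * C0) ^ 2) →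
        C1 - P1 + (P0 + 2 * C0) * (C0 - P0) - 4 * (Y - Q)
        - A * (((P + 2 * th) / 3 * (P1 + 2 * C1 + (P0 + 2 * C0) ^ 2
        - 8 * Y + 2 * Q) + B * n) * w) ≤ 0 := by
      intro P0 C0 P1 C1 Q Y Ff n th w d G2 hF hFn hth hw a1 a2 a3 a4 a5 a6 a7
      have e1 : C1 - P1 + (P0 + 2 * C0) * (C0 - P0) - 4 * (Y - Q)
        - A * (((P + 2 * th) / 3 * (P1 + 2 * C1 + (P0 + 2 * C0) ^ 2
        - 8 * Y + 2 * Q) + B * n) * w)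
        = G2 - 4 * (Y - Q) - A * w * (-(P + 2 * th) * (8 * Y - 2 * Q) / 3 + B * n
          + (4 / 9) * th * (P0 + 2 * C0) ^ 2 - (P + 2 * th) ^ 2 * (P0 + 2 * C0) ^ 2 / 9) := by
        rw [a7]
        linear_combination (P0 + 2 * C0) * a5
      rw [e1]
      set X := -(P + 2 * th) * (8 * Y - 2 * Q) / 3 + B * n
          + (4 / 9) * th * (P0 + 2 * C0) ^ 2 - (P + 2 * th) ^ 2 * (P0 + 2 * C0) ^ 2 / 9 with hX
      have hFX : -l ≤ Ff * X := by
        have : Ff * X = -(P + 2 * th) * (2 / 3 * (Ff * (4 * Y - Q))) + B + 4 * th * ((P0 + 2 * C0) ^ 2 / 9 * Ff)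
            - (P + 2 * th) ^ 2 * ((P0 + 2 * C0) ^ 2 / 9 * Ff) := by
          rw [hX]
          linear_combination B * hFn
        have b1 : (P + 2 * th) * (2 / 3 * (Ff * (4 * Y - Q))) ≤ (P + 2 * th) * 2 :=
          mul_le_mul_of_nonneg_left (by linarith) (by linarith)
        rw [this]
        linarith
      have hAw : 0 ≤ A * w := mul_nonneg hA hw.le
      have b2 := mul_le_mul_of_nonneg_left hFX hAw
      have b3 : 0 ≤ l * (d - A * w) := mul_nonneg hl0 a4.le
      have b4 : Ff * (4 * (Y - Q) + A * w * X) ≥ 0 := by linarith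
      have b5 : 0 ≤ 4 * (Y - Q) + A * w * X := nonneg_of_mul_nonneg_right b4 hF
      linarith
    rw [zero_mul]
    exact key _ _ _ _ _ _ _ _ _ _ _ _ hFp hFN hθ0 hWp hl1 h4 hl2 hG hs hss rfl

end Sys

namespace Sys
variable {T : ℝ} {ρ u v p c p1 c1 p2 c2 p3 c3 q y : ℝ → ℝ → ℝ}

lemma growth {G Gs Gt Gss Gst : ℝ → ℝ → ℝ} {t2 : ℝ} {C : ℝ} (hC : 0 ≤ C)
    (hp : ∀ ξ t : ℝ, 0 < t → t < T → 0 < ρ ξ t)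
    (hG : J T ρ G Gs Gt) (hGs : J T ρ Gs Gss Gst) (h0 : 0 < t2) (h2 : t2 < T)
    (h : ∀ ξ t, t2 < t → t < T → Gs ξ t = 0 → Gss ξ t ≤ 0 → Gt ξ t ≤ C * G ξ t) :
    ∃ N : ℝ, 0 < N ∧ ∀ ξ t, t2 ≤ t → t < T → G ξ t ≤ N := by
  obtain ⟨N, hN, hb⟩ := bdd_at hG.sm hG.per h0 h2
  have J1 : J T ρ (fun x t => G x t - N * Real.exp (C * t)) Gs
      (fun x t => Gt x t - C * (N * Real.exp (C * t))) := by
    refine (hG.add (((J_time.cmul C).exp).cmul (-N))).of_eq ?_ ?_ ?_ <;> intros <;> ring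
  refine ⟨N * Real.exp (C * T), by positivity, ?_⟩
  have := max_principle C hp J1 hGs h0 ?_ ?_
  · intro ξ t ht hT
    have h3 := this ξ t ht hT
    have h4 : Real.exp (C * t) ≤ Real.exp (C * T) := Real.exp_le_exp.mpr (by nlinarith)
    nlinarith
  · intro ξ
    have h3 := (abs_le.mp (hb ξ)).2
    have h4 : 1 ≤ Real.exp (C * t2) := Real.one_le_exp (by positivity)
    have : N * 1 ≤ N * Real.exp (C * t2) := by gcongr
    linarith
  · intro ξ t ht hT hpos hs hss
    have := h ξ t ht hT hs hss
    linarith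

set_option maxHeartbeats 1000000 in
lemma curv_bd (h : Sys T ρ u v p c p1 c1 p2 c2 p3 c3 q y) {t2 U : ℝ} (h0 : 0 < t2) (h2 : t2 < T)
    (hU : ∀ ξ t, t2 ≤ t → t < T → -U ≤ u ξ t) : ∃ K : ℝ, 0 < K ∧ ∀ ξ t, t2 ≤ t → t < T →
      y ξ t ≤ K ∧ p ξ t ^ 2 + c ξ t ^ 2 ≤ K ∧ p1 ξ t ^ 2 + c1 ξ t ^ 2 ≤ K := by
  set Y := Real.exp (2 * U) with hY
  have hYp : 0 < Y := Real.exp_pos _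
  have hy : ∀ ξ t, t2 ≤ t → t < T → y ξ t ≤ Y := by
    intro ξ t ht hT
    rw [h.y_eq]
    refine Real.exp_le_exp.mpr ?_
    linarith [hU ξ t ht hT, h.ord ξ t (by linarith) hT]
  have hq : ∀ ξ t, t2 ≤ t → t < T → q ξ t ≤ Y := fun ξ t ht hT =>
    (h.q_le_y ξ t (by linarith) hT).trans (hy ξ t ht hT)
  have J1 : J T ρ (fun x t => p x t ^ 2 + c x t ^ 2)
      (fun x t => 2 * (p x t * p1 x t + c x t * c1 x t))
      (fun x t => 2 * (p x t * (p2 x t + (p x t + 2 * c x t) * p1 x t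
    - (p x t ^ 2 + 2 * c x t ^ 2) * p x t - 2 * ((2 * p x t - 4 * c x t) * q x t))
      + c x t * (c2 x t + (p x t + 2 * c x t) * c1 x t
    - (p x t ^ 2 + 2 * c x t ^ 2) * c x t + 2 * ((2 * p x t - 4 * c x t) * q x t)
    + 8 * (c x t * y x t)))) := by
    refine ((h.hp.mul h.hp).add (h.hc.mul h.hc)).of_eq ?_ ?_ ?_ <;> intros <;> ring
  have J2 : JJ T ρ (fun x t => 2 * (p x t * p1 x t + c x t * c1 x t))
      (fun x t => 2 * (p1 x t ^ 2 + c1 x t ^ 2 + p x t * p2 x t + c x t * c2 x t)) := by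
    refine (((h.hp.mul h.hp1).add (h.hc.mul h.hc1)).cmul 2).of_eqs ?_ ?_ <;> intros <;> ring
  obtain ⟨K1, hK1, hb1⟩ := growth (C := 20 * Y) (by positivity) h.ρ_pos J1 J2 h0 h2 (by
    intro ξ t ht hT hs hss
    have key : ∀ P C0 P1 C1 P2 C2 Q Yy : ℝ, 0 < Q → 0 < Yy → Q ≤ Y → Yy ≤ Y →
        2 * (P * P1 + C0 * C1) = 0 →
        2 * (P1 ^ 2 + C1 ^ 2 + P * P2 + C0 * C2) ≤ 0 →
        2 * (P * (P2 + (P + 2 * C0) * P1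
          - (P ^ 2 + 2 * C0 ^ 2) * P - 2 * ((2 * P - 4 * C0) * Q))
        + C0 * (C2 + (P + 2 * C0) * C1
          - (P ^ 2 + 2 * C0 ^ 2) * C0 + 2 * ((2 * P - 4 * C0) * Q)
          + 8 * (C0 * Yy))) ≤ 20 * Y * (P ^ 2 + C0 ^ 2) := by
      intro P C0 P1 C1 P2 C2 Q Yy hQ hYy hQY hYY e1 e2
      have f1 : Q * (P ^ 2 + C0 ^ 2) ≤ Y * (P ^ 2 + C0 ^ 2) := by gcongr
      have f2 : Yy * (C0 ^ 2) ≤ Y * (P ^ 2 + C0 ^ 2) :=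
        mul_le_mul hYY (by nlinarith) (by positivity) (by positivity)
      have f3 : 0 ≤ (P ^ 2 + 2 * C0 ^ 2) * (P ^ 2 + C0 ^ 2) := by positivity
      have f4 : 8 * (Q * (3 * P * C0 - P ^ 2 - 2 * C0 ^ 2)) ≤ 8 * (Q * ((1 / 2) * (P ^ 2 + C0 ^ 2))) := by
        have : 3 * P * C0 - P ^ 2 - 2 * C0 ^ 2 ≤ (1 / 2) * (P ^ 2 + C0 ^ 2) := by
          nlinarith [sq_nonneg (P - C0)]
        gcongr
      have f5 : (P + 2 * C0) * (2 * (P * P1 + C0 * C1)) = 0 := by rw [e1, mul_zero]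
      linarith [sq_nonneg P1, sq_nonneg C1]
    exact key _ _ _ _ _ _ _ _ (h.q_pos ξ t) (h.y_pos ξ t) (hq ξ t ht.le hT) (hy ξ t ht.le hT) hs hss)
  have J3 : J T ρ (fun x t => p1 x t ^ 2 + c1 x t ^ 2 + 1)
      (fun x t => 2 * (p1 x t * p2 x t + c1 x t * c2 x t))
      (fun x t => 2 * (p1 x t * (p3 x t + (p x t + 2 * c x t) * p2 x t
    - 2 * (p x t ^ 2 + 2 * c x t ^ 2) * p1 x t
    - (2 * p x t * p1 x t + 4 * c x t * c1 x t) * p x t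
    - 2 * ((2 * p1 x t - 4 * c1 x t) + (2 * p x t - 4 * c x t) ^ 2) * q x t)
      + c1 x t * (c3 x t + (p x t + 2 * c x t) * c2 x t
    - 2 * (p x t ^ 2 + 2 * c x t ^ 2) * c1 x t
    - (2 * p x t * p1 x t + 4 * c x t * c1 x t) * c x t
    + 2 * ((2 * p1 x t - 4 * c1 x t) + (2 * p x t - 4 * c x t) ^ 2) * q x t
    + 8 * (c1 x t - 2 * c x t ^ 2) * y x t))) := by
    refine (((h.hp1.mul h.hp1).add (h.hc1.mul h.hc1)).add (J_const 1)).of_eq ?_ ?_ ?_ <;>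
      intros <;> ring
  have J4 : JJ T ρ (fun x t => 2 * (p1 x t * p2 x t + c1 x t * c2 x t))
      (fun x t => 2 * (p2 x t ^ 2 + c2 x t ^ 2 + p1 x t * p3 x t + c1 x t * c3 x t)) := by
    refine (((h.hp1.mul h.hp2).add (h.hc1.mul h.hc2)).cmul 2).of_eqs ?_ ?_ <;> intros <;> ring
  obtain ⟨K2, hK2, hb2⟩ := growth (C := Y * (20 + 96 * K1)) (by positivity) h.ρ_pos J3 J4 h0 h2 (by
    intro ξ t ht hT hs hss
    have key : ∀ P C0 P1 C1 P2 C2 P3 C3 Q Yy : ℝ, 0 < Q → 0 < Yy → Q ≤ Y → Yy ≤ Y →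
        P ^ 2 + C0 ^ 2 ≤ K1 →
        2 * (P1 * P2 + C1 * C2) = 0 →
        2 * (P2 ^ 2 + C2 ^ 2 + P1 * P3 + C1 * C3) ≤ 0 →
        2 * (P1 * (P3 + (P + 2 * C0) * P2
    - 2 * (P ^ 2 + 2 * C0 ^ 2) * P1
    - (2 * P * P1 + 4 * C0 * C1) * P
    - 2 * ((2 * P1 - 4 * C1) + (2 * P - 4 * C0) ^ 2) * Q)
      + C1 * (C3 + (P + 2 * C0) * C2
    - 2 * (P ^ 2 + 2 * C0 ^ 2) * C1
    - (2 * P * P1 + 4 * C0 * C1) * C0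
    + 2 * ((2 * P1 - 4 * C1) + (2 * P - 4 * C0) ^ 2) * Q
    + 8 * (C1 - 2 * C0 ^ 2) * Yy)) ≤ Y * (20 + 96 * K1) * (P1 ^ 2 + C1 ^ 2 + 1) := by
      intro P C0 P1 C1 P2 C2 P3 C3 Q Yy hQ hYy hQY hYY hK e1 e2
      have f5 : (P + 2 * C0) * (2 * (P1 * P2 + C1 * C2)) = 0 := by rw [e1, mul_zero]
      set G := P1 ^ 2 + C1 ^ 2 + 1 with hG
      have hGp : 0 < G := by positivity
      -- dissipative part
      have g1 : -4 * (P ^ 2 + 2 * C0 ^ 2) * (P1 ^ 2 + C1 ^ 2)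
          - 2 * (2 * P * P1 + 4 * C0 * C1) * (P * P1 + C0 * C1) ≤ 0 := by
        nlinarith [sq_nonneg (P * P1 + C0 * C1), sq_nonneg (P * C1), sq_nonneg (C0 * P1),
          sq_nonneg (C0 * C1), sq_nonneg (P * P1), sq_nonneg (P * C1 + C0 * P1)]
      have g2 : 4 * Q * ((C1 - P1) * (2 * P1 - 4 * C1)) ≤ 4 * Y * G := by
        have : (C1 - P1) * (2 * P1 - 4 * C1) ≤ G := by
          rw [hG]; nlinarith [sq_nonneg (P1 - C1)]
        calc 4 * Q * ((C1 - P1) * (2 * P1 - 4 * C1)) ≤ 4 * Q * G := by gcongr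
          _ ≤ 4 * Y * G := by gcongr
      have g3 : 4 * Q * ((C1 - P1) * (2 * P - 4 * C0) ^ 2) ≤ 80 * Y * K1 * G := by
        have a1 : (2 * P - 4 * C0) ^ 2 ≤ 20 * K1 := by
          nlinarith [sq_nonneg (2 * P + C0)]
        have a2 : C1 - P1 ≤ G := by
          rw [hG]; nlinarith [sq_nonneg (C1 - 1 / 2), sq_nonneg (P1 + 1 / 2)]
        calc 4 * Q * ((C1 - P1) * (2 * P - 4 * C0) ^ 2) ≤ 4 * Q * (G * (2 * P - 4 * C0) ^ 2) := by gcongr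
          _ ≤ 4 * Y * (G * (20 * K1)) := by gcongr
          _ = _ := by ring
      have g4 : 16 * Yy * C1 ^ 2 ≤ 16 * Y * G := by
        have : C1 ^ 2 ≤ G := by rw [hG]; nlinarith [sq_nonneg P1]
        gcongr
      have g5 : 32 * Yy * ((-C1) * C0 ^ 2) ≤ 16 * Y * K1 * G := by
        have a1 : C0 ^ 2 ≤ K1 := by nlinarith [sq_nonneg P]
        have a2 : -C1 ≤ G / 2 := by
          rw [hG]; nlinarith [sq_nonneg (C1 + 1), sq_nonneg P1]
        calc 32 * Yy * ((-C1) * C0 ^ 2) ≤ 32 * Yy * (G / 2 * C0 ^ 2) := by gcongr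
          _ ≤ 32 * Y * (G / 2 * K1) := by gcongr
          _ = _ := by ring
      linarith [sq_nonneg P2, sq_nonneg C2]
    exact key _ _ _ _ _ _ _ _ _ _ (h.q_pos ξ t) (h.y_pos ξ t) (hq ξ t ht.le hT) (hy ξ t ht.le hT)
      (hb1 ξ t ht.le hT) hs hss)
  refine ⟨Y + K1 + K2, by positivity, ?_⟩
  intro ξ t ht hT
  have a1 := hy ξ t ht hT
  have a2 := hb1 ξ t ht hT
  have a3 := hb2 ξ t ht hT
  refine ⟨by linarith, by linarith, by linarith⟩

end Sys

namespace Sys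
variable {T : ℝ} {ρ u v p c p1 c1 p2 c2 p3 c3 q y : ℝ → ℝ → ℝ}

lemma mu_bd (h : Sys T ρ u v p c p1 c1 p2 c2 p3 c3 q y) : ∃ K : ℝ, 0 < K ∧
    ∀ t, T / 2 ≤ t → t < T → ∀ m, 0 ≤ m → (∀ ξ, m ≤ F u v ξ t) → ∀ ξ,
      (p ξ t + 2 * c ξ t) ^ 2 / 9 * F u v ξ t ≤ 1 - m / F u v ξ t + K * F u v ξ t := by
  obtain ⟨K, hK, hb⟩ := h.slope_bd
  refine ⟨K / 4, by positivity, ?_⟩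
  intro t ht hT m hm hF ξ
  have h1 := hb t ht hT m hm hF ξ
  have hFp : 0 < F u v ξ t := F_pos ξ t
  have h2 : 4 * F u v ξ t * ((p ξ t + 2 * c ξ t) ^ 2 / 9 * F u v ξ t)
      ≤ 4 * F u v ξ t * (1 - m / F u v ξ t + K / 4 * F u v ξ t) := by
    have : 4 * F u v ξ t * (1 - m / F u v ξ t + K / 4 * F u v ξ t)
        = 4 * (F u v ξ t - m) + K * F u v ξ t ^ 2 := by
      field_simp
    rw [this]
    nlinarith [mul_nonneg hK.le (sq_nonneg m)]
  exact le_of_mul_le_mul_left h2 (by positivity)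

lemma F_upper (h : Sys T ρ u v p c p1 c1 p2 c2 p3 c3 q y) : ∃ C : ℝ, 0 < C ∧
    ∀ ξ t, T / 2 ≤ t → t < T → F u v ξ t ≤ C := by
  obtain ⟨V, hV, hv⟩ := h.v_upper
  refine ⟨Real.exp (2 * V), by positivity, ?_⟩
  intro ξ t ht hT
  have := h.T_pos
  exact Real.exp_le_exp.mpr (by linarith [hv ξ t ht hT, h.ord ξ t (by linarith) hT])

lemma Fyq (h : Sys T ρ u v p c p1 c1 p2 c2 p3 c3 q y) (ξ t : ℝ) :
    F u v ξ t * (y ξ t - q ξ t) = Real.exp (-(2 / 3) * (v ξ t - u ξ t))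
      * (1 - Real.exp (-2 * (v ξ t - u ξ t))) := by
  have e : Real.exp (-2 * (v ξ t - u ξ t)) = Real.exp (-(2 / 3) * (v ξ t - u ξ t)) ^ 3 := by
    rw [← Real.exp_nat_mul]; congr 1; push_cast; ring
  rw [e, mul_sub, h.Fy, h.Fq]; ring

lemma prelim (h : Sys T ρ u v p c p1 c1 p2 c2 p3 c3 q y) : ∃ κ A : ℝ, 0 < κ ∧ 0 < A ∧
    ∀ ξ t, T / 2 ≤ t → t < T → v ξ t - u ξ t ≤ A * Real.exp (κ / 3 * (u ξ t + 2 * v ξ t)) := by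
  obtain ⟨D, hD, hd⟩ := h.d_upper
  obtain ⟨K, hK, hmu⟩ := h.mu_bd
  obtain ⟨V, hV, hFV⟩ := h.F_upper
  have hT := h.T_pos
  have hz := h.hu.add (h.hv.cmul 2)
  obtain ⟨Z, hZ, hz0⟩ := bdd_at hz.sm hz.per (by linarith : 0 < T / 2) (by linarith)
  set l0 := 8 * Real.exp (-(8 / 3) * D) with hl0
  have hl0p : 0 < l0 := by positivity
  set m := 1 + K * V with hm
  have hmp : 0 < m := by positivity
  have hden : 0 < 2 + m + l0 := by positivity
  set κ := l0 / (2 + m + l0) with hκ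
  have hκp : 0 < κ := by positivity
  have hκ1 : κ ≤ 1 := by rw [hκ, div_le_one hden]; linarith
  have hκ2 : κ * (2 + m) ≤ l0 := by
    rw [hκ, div_mul_eq_mul_div, div_le_iff₀ hden]
    nlinarith
  have hA : 0 < D * Real.exp (κ / 3 * Z) := by positivity
  refine ⟨κ, D * Real.exp (κ / 3 * Z), hκp, hA, ?_⟩
  have hb := h.barrier (P := κ) (B := 0) (A := D * Real.exp (κ / 3 * Z)) (t0 := T / 2) hκp.le le_rfl
    hA.le (by linarith) ?_ ?_
  · simpa using hb
  · intro ξ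
    have h1 := hd ξ (T / 2) le_rfl (by linarith)
    have h2 := (abs_le.mp (hz0 ξ)).1
    simp only [zero_mul, zero_div, sub_zero]
    rw [mul_assoc, ← Real.exp_add]
    have h3 : 1 ≤ Real.exp (κ / 3 * Z + κ / 3 * (u ξ (T / 2) + 2 * v ξ (T / 2))) := by
      refine Real.one_le_exp ?_
      have : 0 ≤ κ / 3 * (Z + (u ξ (T / 2) + 2 * v ξ (T / 2))) :=
        mul_nonneg (by positivity) (by linarith)
      linarith
    nlinarith
  · intro ξ t ht hT1 _
    have hd0 : 0 ≤ v ξ t - u ξ t := by linarith [h.ord ξ t (by linarith) hT1]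
    have hdD := hd ξ t ht.le hT1
    refine ⟨l0, hl0p.le, ?_, ?_⟩
    · rw [h.Fyq]
      set d := v ξ t - u ξ t with hdd
      have a1 : 2 * d * Real.exp (-2 * d) ≤ 1 - Real.exp (-2 * d) := by
        have b1 := Real.add_one_le_exp (2 * d)
        have b2 : Real.exp (2 * d) * Real.exp (-2 * d) = 1 := by
          rw [← Real.exp_add]; simp
        nlinarith [Real.exp_pos (-2 * d)]
      have a2 : Real.exp (-(8 / 3) * D) ≤ Real.exp (-(2 / 3) * d) * Real.exp (-2 * d) := by
        rw [← Real.exp_add]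
        exact Real.exp_le_exp.mpr (by linarith)
      calc l0 * d = 8 * d * Real.exp (-(8 / 3) * D) := by rw [hl0]; ring
        _ ≤ 8 * d * (Real.exp (-(2 / 3) * d) * Real.exp (-2 * d)) := by gcongr
        _ = 4 * (Real.exp (-(2 / 3) * d) * (2 * d * Real.exp (-2 * d))) := by ring
        _ ≤ _ := by gcongr
    · have h1 := hmu t ht.le hT1 0 le_rfl (fun ξ => (F_pos ξ t).le) ξ
      have h2 := hFV ξ t ht.le hT1
      simp only [zero_mul, zero_div, mul_zero, add_zero, sub_zero] at h1 ⊢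
      have h3 : (p ξ t + 2 * c ξ t) ^ 2 / 9 * F u v ξ t ≤ m := by
        rw [hm]; nlinarith
      have h4 : κ ^ 2 * ((p ξ t + 2 * c ξ t) ^ 2 / 9 * F u v ξ t) ≤ κ * m := by
        have : κ ^ 2 ≤ κ := by nlinarith
        have h0 : 0 ≤ (p ξ t + 2 * c ξ t) ^ 2 / 9 * F u v ξ t :=
          mul_nonneg (by positivity) (F_pos ξ t).le
        exact mul_le_mul this h3 h0 hκp.le
      linarith

set_option maxHeartbeats 2000000 in
lemma final_bd (h : Sys T ρ u v p c p1 c1 p2 c2 p3 c3 q y) {b t1 : ℝ} (hb : 0 < b) (hb1 : b ≤ 1)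
    (ht1 : T / 2 ≤ t1) (ht1T : t1 < T)
    (hlow : ∀ ξ t, t1 ≤ t → t < T → b * (T - t) ≤ F u v ξ t)
    {δ : ℝ} (hδ : 0 < δ) (hδ1 : δ ≤ b / 52) : ∃ A : ℝ, 0 < A ∧
    ∀ ξ t, t1 ≤ t → t < T →
      v ξ t - u ξ t ≤ A * Real.exp ((2 + 2 * δ) / 3 * (u ξ t + 2 * v ξ t)) := by
  obtain ⟨D, hD, hd⟩ := h.d_upper
  obtain ⟨K, hK, hmu⟩ := h.mu_bd
  obtain ⟨κ, A1, hκ, hA1, hpre⟩ := h.prelim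
  have hT := h.T_pos
  have hz := h.hu.add (h.hv.cmul 2)
  obtain ⟨Z, hZ, hz0⟩ := bdd_at hz.sm hz.per (by linarith : 0 < t1) ht1T
  obtain ⟨E, hE1, hE2⟩ : ∃ E : ℝ, A1 * Real.exp (κ / 3 * E) ≤ δ / 88 ∧
      6 * K * Real.exp (2 / 3 * E) ≤ δ / 4 := by
    have l1 : Tendsto (fun E : ℝ => A1 * Real.exp (κ / 3 * E)) atBot (𝓝 (A1 * 0)) :=
      (Real.tendsto_exp_atBot.comp (tendsto_id.const_mul_atBot (by positivity))).const_mul _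
    have l2 : Tendsto (fun E : ℝ => 6 * K * Real.exp (2 / 3 * E)) atBot (𝓝 (6 * K * 0)) :=
      (Real.tendsto_exp_atBot.comp (tendsto_id.const_mul_atBot (by positivity))).const_mul _
    rw [mul_zero] at l1 l2
    exact ((l1.eventually (ge_mem_nhds (by positivity))).and
      (l2.eventually (ge_mem_nhds (by positivity)))).exists
  set P := 2 + 2 * δ with hP
  have hPp : 0 < P := by positivity
  set E' := min E (-Z) with hE'
  set A := D * Real.exp (13 * δ / b - P / 3 * E') with hA
  have hAp : 0 < A := by positivity
  -- the ratio
  have hζ : ∀ ξ t, t1 ≤ t → t < T → (T - t) / F u v ξ t ≤ 1 / b := by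
    intro ξ t h1 h2
    rw [div_le_div_iff₀ (F_pos ξ t) hb]
    linarith [hlow ξ t h1 h2]
  have hζ0 : ∀ ξ t, t1 ≤ t → t < T → 0 < (T - t) / F u v ξ t := by
    intro ξ t h1 h2
    exact div_pos (by linarith) (F_pos ξ t)
  have hbig : ∀ ξ t, t1 ≤ t → t < T → E' ≤ u ξ t + 2 * v ξ t →
      D ≤ A * Real.exp (P / 3 * (u ξ t + 2 * v ξ t) - 13 * δ * (T - t) / F u v ξ t) := by
    intro ξ t h1 h2 h3
    rw [hA, mul_assoc, ← Real.exp_add]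
    have h4 := hζ ξ t h1 h2
    have h5 : 1 ≤ Real.exp (13 * δ / b - P / 3 * E'
        + (P / 3 * (u ξ t + 2 * v ξ t) - 13 * δ * (T - t) / F u v ξ t)) := by
      refine Real.one_le_exp ?_
      have a1 : 13 * δ * ((T - t) / F u v ξ t) ≤ 13 * δ * (1 / b) := by gcongr
      have a2 : P / 3 * E' ≤ P / 3 * (u ξ t + 2 * v ξ t) := by gcongr
      rw [mul_one_div] at a1
      rw [mul_div_assoc (13 * δ) (T - t)]
      linarith
    nlinarith
  have hbar := h.barrier (P := P) (B := 13 * δ) (A := A) (t0 := t1) hPp.le (by positivity)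
    hAp.le (by linarith) ?_ ?_
  · refine ⟨A, hAp, ?_⟩
    intro ξ t h1 h2
    refine (hbar ξ t h1 h2).trans ?_
    have := hζ0 ξ t h1 h2
    have h3 : 0 ≤ 13 * δ * (T - t) / F u v ξ t := by rw [mul_div_assoc]; positivity
    have : Real.exp (P / 3 * (u ξ t + 2 * v ξ t) - 13 * δ * (T - t) / F u v ξ t)
      ≤ Real.exp (P / 3 * (u ξ t + 2 * v ξ t)) := Real.exp_le_exp.mpr (by linarith)
    gcongr
  · intro ξ
    refine (hd ξ t1 ht1 ht1T).trans (hbig ξ t1 le_rfl ht1T ?_)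
    have h2 := (abs_le.mp (hz0 ξ)).1
    exact (min_le_right _ _).trans h2
  · intro ξ t ht hT1 hviol
    have hZE : u ξ t + 2 * v ξ t < E := by
      by_contra hcon
      push Not at hcon
      have := hbig ξ t ht.le hT1 ((min_le_left _ _).trans hcon)
      linarith [hd ξ t (by linarith) hT1]
    have hd0 : 0 ≤ v ξ t - u ξ t := by linarith [h.ord ξ t (by linarith) hT1]
    have hdsm : v ξ t - u ξ t ≤ δ / 88 := by
      refine (hpre ξ t (by linarith) hT1).trans (le_trans ?_ hE1)
      gcongr
    have hFsm : 6 * K * F u v ξ t ≤ δ / 4 := by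
      refine le_trans ?_ hE2
      unfold F
      gcongr
    have hδs : δ ≤ 1 / 52 := by linarith
    refine ⟨8 - 22 * (v ξ t - u ξ t), by linarith, ?_, ?_⟩
    · rw [h.Fyq]
      set d := v ξ t - u ξ t with hdd
      have a1 : 1 - 2 / 3 * d ≤ Real.exp (-(2 / 3) * d) := by
        linarith [Real.add_one_le_exp (-(2 / 3) * d)]
      have a2 : 2 * d - 4 * d ^ 2 ≤ 1 - Real.exp (-2 * d) := by
        have b1 := Real.add_one_le_exp (2 * d)
        have b2 : Real.exp (2 * d) * Real.exp (-2 * d) = 1 := by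
          rw [← Real.exp_add]; simp
        have b3 := Real.exp_pos (-2 * d)
        have b4 : (2 * d + 1) * Real.exp (-2 * d) ≤ 1 := by nlinarith
        have b5 : (2 * d + 1) * Real.exp (-2 * d) ≤ (2 * d + 1) * (1 - 2 * d + 4 * d ^ 2) := by
          have : 0 ≤ d ^ 3 := by positivity
          nlinarith
        have := le_of_mul_le_mul_left b5 (by linarith)
        linarith
      have a3 : (1 - 2 / 3 * d) * (2 * d - 4 * d ^ 2)
          ≤ Real.exp (-(2 / 3) * d) * (1 - Real.exp (-2 * d)) :=
        mul_le_mul a1 a2 (by nlinarith) (Real.exp_pos _).le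
      have a4 : 0 ≤ d ^ 3 := by positivity
      nlinarith [sq_nonneg d]
    · have h1 := hmu t (by linarith) hT1 (b * (T - t)) (mul_nonneg hb.le (by linarith))
        (fun ξ => hlow ξ t ht.le hT1) ξ
      have z1 := hζ ξ t ht.le hT1
      have z0 := hζ0 ξ t ht.le hT1
      have hFp : 0 < F u v ξ t := F_pos ξ t
      rw [mul_div_assoc] at h1 ⊢
      have hmu0 : 0 ≤ (p ξ t + 2 * c ξ t) ^ 2 / 9 * F u v ξ t := by positivity
      set μ := (p ξ t + 2 * c ξ t) ^ 2 / 9 * F u v ξ t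
      set ζ := (T - t) / F u v ξ t
      set Ff := F u v ξ t
      set d := v ξ t - u ξ t
      have zb : b * ζ ≤ 1 := by
        have := mul_le_mul_of_nonneg_left z1 hb.le
        rwa [mul_one_div_cancel hb.ne'] at this
      set θ := 13 * δ * ζ with hθ
      have hθ0 : 0 ≤ θ := by positivity
      have hθ1 : θ ≤ 1 / 4 := by
        have : 13 * δ * ζ ≤ 13 * (b / 52) * ζ := by gcongr
        nlinarith
      set Jq := (P + 2 * θ) ^ 2 - 4 * θ with hJ
      have hJe : Jq = 4 + 8 * δ + 4 * θ + 4 * (δ + θ) ^ 2 := by rw [hJ, hP]; ring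
      have hJ4 : 4 ≤ Jq := by rw [hJe]; nlinarith [sq_nonneg (δ + θ)]
      have hJ6 : Jq ≤ 6 := by rw [hJe]; nlinarith
      have hJμ : Jq * μ ≤ Jq - 4 * (b * ζ) + δ / 4 := by
        have a1 : Jq * μ ≤ Jq * (1 - b * ζ + K * Ff) := mul_le_mul_of_nonneg_left h1 (by linarith)
        have a2 : 4 * (b * ζ) ≤ Jq * (b * ζ) := mul_le_mul_of_nonneg_right hJ4 (by positivity)
        have a3 : Jq * (K * Ff) ≤ 6 * (K * Ff) := mul_le_mul_of_nonneg_right hJ6 (by positivity)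
        linarith
      have hsq : 4 * (δ + θ) ^ 2 ≤ 8 * δ ^ 2 + 8 * θ ^ 2 := by nlinarith [sq_nonneg (δ - θ)]
      have hθ2 : 8 * θ ^ 2 ≤ 2 * (b * ζ) := by
        have : θ ≤ b * ζ / 4 := by
          have : 13 * δ * ζ ≤ 13 * (b / 52) * ζ := by gcongr
          linarith
        nlinarith
      have hθ3 : 8 * θ ≤ 2 * (b * ζ) := by
        have : 13 * δ * ζ ≤ 13 * (b / 52) * ζ := by gcongr
        linarith
      have hδ2 : 8 * δ ^ 2 ≤ δ / 2 := by nlinarith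
      have e1 : 13 * δ - 2 * (P + 2 * θ) = 9 * δ - 4 - 4 * θ := by rw [hP]; ring
      rw [e1]
      rw [hJe] at hJμ
      rw [hJe]
      linarith

end Sys

lemma Ds_log {T : ℝ} {ρ f : ℝ → ℝ → ℝ} (hp : ∀ ξ t : ℝ, 0 < t → t < T → 0 < ρ ξ t)
    (hρ : Sm T ρ) (hρp : Per ρ)
    (hf : Sm T f) (hfp : Per f) (hpos : ∀ ξ t : ℝ, 0 < t → t < T → 0 < f ξ t)
    (ξ t : ℝ) (h0 : 0 < t) (h1 : t < T) :
    Ds ρ f ξ t = f ξ t * Ds ρ (fun x t => Real.log (f x t)) ξ t ∧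
    Ds ρ (Ds ρ f) ξ t = f ξ t * (Ds ρ (Ds ρ (fun x t => Real.log (f x t))) ξ t
      + Ds ρ (fun x t => Real.log (f x t)) ξ t ^ 2) ∧
    pdt (fun x t => Real.log (f x t)) ξ t = pdt f ξ t / f ξ t := by
  have Jf : J T ρ f (Ds ρ f) (pdt f) := J_of_Sm hf hfp hp
  have Ju := Jf.log hpos
  have Jp := J_of_Sm (Ju.sm.Ds hρ hp) (Ju.per.Ds hρp) hp
  have Jfs := J_of_Sm (hf.Ds hρ hp) (hfp.Ds hρp) hp
  have e1 : ∀ x, Ds ρ f x t = f x t * Ds ρ (fun x t => Real.log (f x t)) x t := by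
    intro x
    rw [Ju.Ds_eq hp h0 h1]
    have := (hpos x t h0 h1).ne'
    field_simp
  refine ⟨e1 ξ, ?_, Ju.pdt_eq h0 h1⟩
  have d1 := (Jf.s ξ t h0 h1).mul (Jp.s ξ t h0 h1)
  have d2 := Jfs.s ξ t h0 h1
  have e2 : (fun x => Ds ρ f x t)
      = (fun x => f x t) * fun x => Ds ρ (fun x t => Real.log (f x t)) x t := funext e1
  rw [e2] at d2
  have e3 := d2.unique d1
  have hr := hp ξ t h0 h1
  rw [e1 ξ] at e3
  refine mul_left_cancel₀ hr.ne' ?_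
  rw [e3]; ring

set_option maxHeartbeats 2000000 in
lemma AssumptionC.sys {T : ℝ} {f g ρ : ℝ → ℝ → ℝ} (sol : AssumptionC T f g ρ) :
    ∃ p c p1 c1 p2 c2 p3 c3 q y : ℝ → ℝ → ℝ,
      Sys T ρ (fun x t => Real.log (f x t)) (fun x t => Real.log (g x t))
        p c p1 c1 p2 c2 p3 c3 q y ∧
      ∀ ξ t : ℝ, 0 < t → t < T →
        k01 ρ f ξ t = -(p1 ξ t + p ξ t ^ 2) ∧ k02 ρ g ξ t = -(c1 ξ t + c ξ t ^ 2) ∧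
        k12 ρ f g ξ t = q ξ t - p ξ t * c ξ t ∧
        k23 ρ f g ξ t = 4 * y ξ t - 3 * q ξ t - c ξ t ^ 2 := by
  have hT := sol.T_pos
  have fpos : ∀ ξ t : ℝ, 0 < t → t < T → 0 < f ξ t := fun ξ t h0 h1 => sol.f_pos ξ t h0.le h1
  have gpos : ∀ ξ t : ℝ, 0 < t → t < T → 0 < g ξ t := fun ξ t h0 h1 => sol.g_pos ξ t h0.le h1
  have hp : ∀ ξ t : ℝ, 0 < t → t < T → 0 < ρ ξ t := fun ξ t h0 h1 => sol.ρ_pos ξ t h0.le h1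
  have hsub : (Set.univ : Set ℝ) ×ˢ Set.Ioo 0 T ⊆ (Set.univ : Set ℝ) ×ˢ Set.Ico 0 T :=
    Set.prod_mono le_rfl Set.Ioo_subset_Ico_self
  have sf : Sm T f := (ContDiffOn.fst sol.smooth).mono hsub
  have sg : Sm T g := (ContDiffOn.fst (ContDiffOn.snd sol.smooth)).mono hsub
  have sρ : Sm T ρ := (ContDiffOn.snd (ContDiffOn.snd sol.smooth)).mono hsub
  have pf : Per f := sol.f_per
  have pg : Per g := sol.g_per
  have pρ : Per ρ := sol.ρ_per
  have lf := Ds_log hp sρ pρ sf pf fpos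
  have lg := Ds_log hp sρ pρ sg pg gpos
  have Jρ : J T ρ ρ (Ds ρ ρ) (pdt ρ) := J_of_Sm sρ pρ hp
  have Ju0 := (J_of_Sm sf pf hp).log fpos
  have Jv0 := (J_of_Sm sg pg hp).log gpos
  set u : ℝ → ℝ → ℝ := fun x t => Real.log (f x t) with hu
  set v : ℝ → ℝ → ℝ := fun x t => Real.log (g x t) with hv
  have su : Sm T u := Ju0.sm
  have sv : Sm T v := Jv0.sm
  have pu : Per u := Ju0.per
  have pv : Per v := Jv0.per
  set p := Ds ρ u with hpd
  have sp : Sm T p := su.Ds sρ hp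
  have pp : Per p := pu.Ds pρ
  set c := Ds ρ v with hcd
  have sc : Sm T c := sv.Ds sρ hp
  have pc : Per c := pv.Ds pρ
  set p1 := Ds ρ p with hp1d
  have sp1 : Sm T p1 := sp.Ds sρ hp
  have pp1 : Per p1 := pp.Ds pρ
  set c1 := Ds ρ c with hc1d
  have sc1 : Sm T c1 := sc.Ds sρ hp
  have pc1 : Per c1 := pc.Ds pρ
  set p2 := Ds ρ p1 with hp2d
  have sp2 : Sm T p2 := sp1.Ds sρ hp
  have pp2 : Per p2 := pp1.Ds pρ
  set c2 := Ds ρ c1 with hc2d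
  have sc2 : Sm T c2 := sc1.Ds sρ hp
  have pc2 : Per c2 := pc1.Ds pρ
  have Jp : JJ T ρ p p1 := J_of_Sm sp pp hp
  have Jc : JJ T ρ c c1 := J_of_Sm sc pc hp
  have Jp1 : JJ T ρ p1 p2 := J_of_Sm sp1 pp1 hp
  have Jc1 : JJ T ρ c1 c2 := J_of_Sm sc1 pc1 hp
  have Jp2 : JJ T ρ p2 (Ds ρ p2) := J_of_Sm sp2 pp2 hp
  have Jc2 : JJ T ρ c2 (Ds ρ c2) := J_of_Sm sc2 pc2 hp
  obtain ⟨q, hq⟩ : ∃ q : ℝ → ℝ → ℝ, ∀ ξ t, q ξ t = Real.exp (2 * u ξ t - 4 * v ξ t) :=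
    ⟨fun ξ t => Real.exp (2 * u ξ t - 4 * v ξ t), fun _ _ => rfl⟩
  obtain ⟨y, hy⟩ : ∃ y : ℝ → ℝ → ℝ, ∀ ξ t, y ξ t = Real.exp (-2 * v ξ t) :=
    ⟨fun ξ t => Real.exp (-2 * v ξ t), fun _ _ => rfl⟩
  have eu : ∀ ξ t, 0 < t → t < T → Real.exp (u ξ t) = f ξ t := fun ξ t h0 h1 =>
    Real.exp_log (fpos ξ t h0 h1)
  have ev : ∀ ξ t, 0 < t → t < T → Real.exp (v ξ t) = g ξ t := fun ξ t h0 h1 =>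
    Real.exp_log (gpos ξ t h0 h1)
  have eq' : ∀ ξ t, 0 < t → t < T → q ξ t = f ξ t ^ 2 / g ξ t ^ 4 := by
    intro ξ t h0 h1
    rw [hq, ← eu ξ t h0 h1, ← ev ξ t h0 h1, Real.exp_sub, ← Real.exp_nat_mul, ← Real.exp_nat_mul]
    norm_num
  have ey' : ∀ ξ t, 0 < t → t < T → y ξ t = 1 / g ξ t ^ 2 := by
    intro ξ t h0 h1
    rw [hy, ← ev ξ t h0 h1, ← Real.exp_nat_mul, one_div, ← Real.exp_neg]
    norm_num
  have Ju : J T ρ u p (fun x t => p1 x t + (p x t + 2 * c x t) * p x t - 2 * q x t) := by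
    refine (J_of_Sm su pu hp).congr (fun _ _ _ _ => rfl) ?_
    intro ξ t h0 h1
    obtain ⟨a1, a2, a3⟩ := lf ξ t h0 h1
    obtain ⟨b1, b2, b3⟩ := lg ξ t h0 h1
    have hf := (fpos ξ t h0 h1).ne'
    have hg := (gpos ξ t h0 h1).ne'
    rw [a3, sol.eq_f ξ t h0 h1, a2, a1, b1, eq' ξ t h0 h1]
    field_simp
    ring
  have Jv : J T ρ v c (fun x t => c1 x t + (p x t + 2 * c x t) * c x t + 2 * q x t - 4 * y x t) := by
    refine (J_of_Sm sv pv hp).congr (fun _ _ _ _ => rfl) ?_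
    intro ξ t h0 h1
    obtain ⟨a1, a2, a3⟩ := lf ξ t h0 h1
    obtain ⟨b1, b2, b3⟩ := lg ξ t h0 h1
    have hf := (fpos ξ t h0 h1).ne'
    have hg := (gpos ξ t h0 h1).ne'
    rw [b3, sol.eq_g ξ t h0 h1, b2, a1, b1, eq' ξ t h0 h1, ey' ξ t h0 h1]
    field_simp
    ring
  have hL : ∀ ξ t : ℝ, 0 < t → t < T → pdt ρ ξ t
      = (p1 ξ t + p ξ t ^ 2 + 2 * (c1 ξ t + c ξ t ^ 2)) * ρ ξ t := by
    intro ξ t h0 h1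
    obtain ⟨a1, a2, a3⟩ := lf ξ t h0 h1
    obtain ⟨b1, b2, b3⟩ := lg ξ t h0 h1
    have hf := (fpos ξ t h0 h1).ne'
    have hg := (gpos ξ t h0 h1).ne'
    have hr := (hp ξ t h0 h1).ne'
    have e := sol.eq_ρ ξ t h0 h1
    rw [(Jρ.log hp).pdt_eq h0 h1, a2, b2] at e
    field_simp at e
    rw [e]
    ring
  have Jq : J T ρ q (fun x t => (2 * p x t - 4 * c x t) * q x t)
    (fun x t => (2 * (p1 x t + (p x t + 2 * c x t) * p x t - 2 * q x t)
      - 4 * (c1 x t + (p x t + 2 * c x t) * c x t + 2 * q x t - 4 * y x t)) * q x t) := by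
    refine (((Ju.cmul 2).add (Jv.cmul (-4))).exp).of_eq ?_ ?_ ?_ <;> intro x t <;>
      simp only [hq] <;> ring_nf
  have Jy : J T ρ y (fun x t => -2 * c x t * y x t)
    (fun x t => -2 * (c1 x t + (p x t + 2 * c x t) * c x t + 2 * q x t - 4 * y x t) * y x t) := by
    refine ((Jv.cmul (-2)).exp).of_eq ?_ ?_ ?_ <;> intro x t <;>
      simp only [hy] <;> ring_nf
  have Hp : J T ρ p p1 (fun x t => p2 x t + (p x t + 2 * c x t) * p1 x t
    - (p x t ^ 2 + 2 * c x t ^ 2) * p x t - 2 * ((2 * p x t - 4 * c x t) * q x t)) := by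
    have ht := (Jp1.add ((Jp.add (Jc.cmul 2)).mul Jp)).add (Jq.cmul (-2))
    refine (J.comm Jρ hp hL Ju Jp (ht.of_eqs (a2 := fun x t => p1 x t
      + (p x t + 2 * c x t) * p x t - 2 * q x t) ?_ (fun _ _ => rfl))).of_eq ?_ ?_ ?_ <;>
      intros <;> ring
  have Hc : J T ρ c c1 (fun x t => c2 x t + (p x t + 2 * c x t) * c1 x t
    - (p x t ^ 2 + 2 * c x t ^ 2) * c x t + 2 * ((2 * p x t - 4 * c x t) * q x t)
    + 8 * (c x t * y x t)) := by
    have ht := ((Jc1.add ((Jp.add (Jc.cmul 2)).mul Jc)).add (Jq.cmul 2)).add (Jy.cmul (-4))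
    refine (J.comm Jρ hp hL Jv Jc (ht.of_eqs (a2 := fun x t => c1 x t
      + (p x t + 2 * c x t) * c x t + 2 * q x t - 4 * y x t) ?_ (fun _ _ => rfl))).of_eq ?_ ?_ ?_ <;>
      intros <;> ring
  have Hp1 : J T ρ p1 p2 (fun x t => (Ds ρ p2) x t + (p x t + 2 * c x t) * p2 x t
    - 2 * (p x t ^ 2 + 2 * c x t ^ 2) * p1 x t
    - (2 * p x t * p1 x t + 4 * c x t * c1 x t) * p x t
    - 2 * ((2 * p1 x t - 4 * c1 x t) + (2 * p x t - 4 * c x t) ^ 2) * q x t) := by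
    have ht := ((Jp2.add ((Jp.add (Jc.cmul 2)).mul Jp1)).add
      ((((Jp.mul Jp).add ((Jc.mul Jc).cmul 2)).mul Jp).cmul (-1))).add
      ((((Jp.cmul 2).add (Jc.cmul (-4))).mul Jq).cmul (-2))
    refine (J.comm Jρ hp hL Hp Jp1 (ht.of_eqs (a2 := fun x t => p2 x t
      + (p x t + 2 * c x t) * p1 x t
    - (p x t ^ 2 + 2 * c x t ^ 2) * p x t - 2 * ((2 * p x t - 4 * c x t) * q x t))
      ?_ (fun _ _ => rfl))).of_eq ?_ ?_ ?_ <;>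
      intros <;> ring
  have Hc1 : J T ρ c1 c2 (fun x t => (Ds ρ c2) x t + (p x t + 2 * c x t) * c2 x t
    - 2 * (p x t ^ 2 + 2 * c x t ^ 2) * c1 x t
    - (2 * p x t * p1 x t + 4 * c x t * c1 x t) * c x t
    + 2 * ((2 * p1 x t - 4 * c1 x t) + (2 * p x t - 4 * c x t) ^ 2) * q x t
    + 8 * (c1 x t - 2 * c x t ^ 2) * y x t) := by
    have ht := (((Jc2.add ((Jp.add (Jc.cmul 2)).mul Jc1)).add
      ((((Jp.mul Jp).add ((Jc.mul Jc).cmul 2)).mul Jc).cmul (-1))).add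
      ((((Jp.cmul 2).add (Jc.cmul (-4))).mul Jq).cmul 2)).add ((Jc.mul Jy).cmul 8)
    refine (J.comm Jρ hp hL Hc Jc1 (ht.of_eqs (a2 := fun x t => c2 x t
      + (p x t + 2 * c x t) * c1 x t
    - (p x t ^ 2 + 2 * c x t ^ 2) * c x t + 2 * ((2 * p x t - 4 * c x t) * q x t)
    + 8 * (c x t * y x t))
      ?_ (fun _ _ => rfl))).of_eq ?_ ?_ ?_ <;>
      intros <;> ring
  have hord : ∀ ξ t, 0 ≤ t → t < T → u ξ t - v ξ t ≤ 0 := by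
    have cf : ContinuousOn (fun p : ℝ × ℝ => f p.1 p.2) (Set.univ ×ˢ Set.Ico 0 T) :=
      (ContDiffOn.fst sol.smooth).continuousOn
    have cg : ContinuousOn (fun p : ℝ × ℝ => g p.1 p.2) (Set.univ ×ˢ Set.Ico 0 T) :=
      (ContDiffOn.fst (ContDiffOn.snd sol.smooth)).continuousOn
    refine max_principle0 (K := 0) (G := fun x t => u x t - v x t)
      (fun ξ t => by simp only [pu ξ t, pv ξ t]) ?_ ?_ ?_
    · exact (cf.log (fun p hp => (sol.f_pos p.1 p.2 hp.2.1 hp.2.2).ne')).sub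
        (cg.log (fun p hp => (sol.g_pos p.1 p.2 hp.2.1 hp.2.2).ne'))
    · intro ξ
      have := Real.log_le_log (sol.f_pos ξ 0 le_rfl hT) (sol.init_order ξ)
      simp only [hu, hv]
      linarith
    · intro ξ t h0 h1 hpos hmax
      have j1 : J T ρ (fun x t => u x t - v x t) (fun x t => p x t - c x t)
          (fun x t => p1 x t - c1 x t + (p x t + 2 * c x t) * (p x t - c x t)
            - 4 * q x t + 4 * y x t) := by
        refine (Ju.add (Jv.cmul (-1))).of_eq ?_ ?_ ?_ <;> intros <;> ring
      have j2 : JJ T ρ (fun x t => p x t - c x t) (fun x t => p1 x t - c1 x t) := by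
        refine (Jp.add (Jc.cmul (-1))).of_eqs ?_ ?_ <;> intros <;> ring
      obtain ⟨m1, m2⟩ := max_crit hp j1 j2 h0 h1 hmax
      refine ⟨_, j1.t ξ t h0 h1, ?_⟩
      have hqy : y ξ t ≤ q ξ t := by
        rw [hy, hq]
        exact Real.exp_le_exp.mpr (by linarith)
      have m1' : p ξ t - c ξ t = 0 := m1
      have m2' : p1 ξ t - c1 ξ t ≤ 0 := m2
      rw [m1', zero_mul]
      linarith
  refine ⟨p, c, p1, c1, p2, c2, Ds ρ p2, Ds ρ c2, q, y,
    ⟨hT, hp, hq, hy, Ju, Jv, Hp, Hc, Hp1, Hc1, Jp2, Jc2, Jq, Jy, ?_⟩, ?_⟩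
  · intro ξ t h0 h1
    linarith [hord ξ t h0.le h1]
  · intro ξ t h0 h1
    obtain ⟨a1, a2, a3⟩ := lf ξ t h0 h1
    obtain ⟨b1, b2, b3⟩ := lg ξ t h0 h1
    have hf := (fpos ξ t h0 h1).ne'
    have hg := (gpos ξ t h0 h1).ne'
    refine ⟨?_, ?_, ?_, ?_⟩
    · rw [k01, a2]; field_simp
    · rw [k02, b2]; field_simp
    · rw [k12, a1, b1, eq' ξ t h0 h1]; field_simp
    · rw [k23, b1, eq' ξ t h0 h1, ey' ξ t h0 h1]; field_simp

namespace Sys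
variable {T : ℝ} {ρ u v p c p1 c1 p2 c2 p3 c3 q y : ℝ → ℝ → ℝ}

lemma even_zero {a as at' : ℝ → ℝ → ℝ} (hp : ∀ ξ t : ℝ, 0 < t → t < T → 0 < ρ ξ t)
    (h : J T ρ a as at') (he : ∀ ξ t, a (-ξ) t = a ξ t) (t : ℝ) (h0 : 0 < t) (h1 : t < T) :
    as 0 t = 0 := by
  have d1 := h.s 0 t h0 h1
  have d1' : HasDerivAt (fun x => a x t) (ρ 0 t * as 0 t) (-0) := by rw [neg_zero]; exact d1
  have d2 : HasDerivAt (fun x => a (-x) t) (ρ 0 t * as 0 t * (-1)) 0 :=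
    d1'.comp 0 (hasDerivAt_neg 0)
  have e : (fun x => a (-x) t) = fun x => a x t := funext fun x => he x t
  rw [e] at d2
  have e2 := d1.unique d2
  have hr := hp 0 t h0 h1
  have : ρ 0 t * as 0 t = 0 := by linarith
  exact (mul_eq_zero.mp this).resolve_left hr.ne'

lemma neck (h : Sys T ρ u v p c p1 c1 p2 c2 p3 c3 q y) {t1 : ℝ} (ht1 : T / 2 ≤ t1) (ht1T : t1 < T)
    (hmin : ∀ ξ t, t1 < t → t < T → u 0 t ≤ u ξ t)
    (heu : ∀ ξ t, u (-ξ) t = u ξ t) (hev : ∀ ξ t, v (-ξ) t = v ξ t)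
    (hblow : ∀ U t2, 0 < t2 → t2 < T → ¬ ∀ ξ t, t2 ≤ t → t < T → -U ≤ u ξ t) :
    ∃ b C t2 : ℝ, 0 < b ∧ b ≤ 1 ∧ 0 < C ∧ T / 2 ≤ t2 ∧ t2 < T ∧
      (∀ ξ t, t2 ≤ t → t < T → b * (T - t) ≤ F u v ξ t) ∧
      ∀ t, t2 ≤ t → t < T → F u v 0 t ≤ C * (T - t) := by
  have hT := h.T_pos
  obtain ⟨D, hD, hd⟩ := h.d_upper
  obtain ⟨CR, hCR, hR⟩ := h.R_lower
  have p0 := even_zero h.ρ_pos h.hu heu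
  have c0 := even_zero h.ρ_pos h.hv hev
  have hp1 : ∀ t, t1 < t → t < T → 0 ≤ p1 0 t := by
    intro t h0 h1
    have := (max_crit h.ρ_pos (h.hu.cmul (-1)) (h.hp.cmul (-1)) (by linarith : 0 < t) h1
      (ξ := 0) (fun η => by linarith [hmin η t h0 h1])).2
    linarith
  -- upper bound at the neck
  have hw : ∀ t, t1 < t → t < T → Real.exp (2 * u 0 t) ≤ 4 * (T - t) := by
    have hmono : MonotoneOn (fun t => Real.exp (2 * u 0 t) + 4 * t) (Set.Ioo t1 T) := by
      have hder : ∀ t ∈ Set.Ioo t1 T, HasDerivAt (fun t => Real.exp (2 * u 0 t) + 4 * t)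
          (2 * (p1 0 t + (p 0 t + 2 * c 0 t) * p 0 t - 2 * q 0 t) * Real.exp (2 * u 0 t) + 4) t := by
        intro t ht
        have := ((h.hu.cmul 2).exp.add (J_time.cmul 4)).t 0 t (by linarith [ht.1]) ht.2
        simpa using this
      refine monotoneOn_of_deriv_nonneg (convex_Ioo _ _)
        (fun t ht => (hder t ht).continuousAt.continuousWithinAt) ?_ ?_
      · rw [interior_Ioo]
        exact fun t ht => (hder t ht).differentiableAt.differentiableWithinAt
      · rw [interior_Ioo]
        intro t ht
        rw [(hder t ht).deriv, p0 t (by linarith [ht.1]) ht.2]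
        have e1 : q 0 t * Real.exp (2 * u 0 t) ≤ 1 := by
          rw [h.q_eq, ← Real.exp_add]
          refine Real.exp_le_one_iff.mpr ?_
          linarith [h.ord 0 t (by linarith [ht.1]) ht.2]
        have e2 : 0 ≤ p1 0 t * Real.exp (2 * u 0 t) :=
          mul_nonneg (hp1 t ht.1 ht.2) (Real.exp_pos _).le
        linarith
    intro t h0 h1
    by_contra hcon
    push Not at hcon
    set ε := Real.exp (2 * u 0 t) - 4 * (T - t) with hε
    have hεp : 0 < ε := by linarith
    refine hblow (-(Real.log ε / 2)) t (by linarith) h1 ?_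
    intro ξ s hs1 hs2
    have h3 := hmono ⟨h0, h1⟩ ⟨by linarith, hs2⟩ hs1
    simp only at h3
    have h4 : ε ≤ Real.exp (2 * u 0 s) := by linarith
    have h5 := (Real.log_le_iff_le_exp hεp).mpr h4
    have h6 := hmin ξ s (by linarith) hs2
    linarith
  have hF0 : ∀ t, t1 < t → t < T → F u v 0 t ≤ 4 * Real.exp (4 / 3 * D) * (T - t) := by
    intro t h0 h1
    have e1 : F u v 0 t = Real.exp (2 * u 0 t) * Real.exp (4 / 3 * (v 0 t - u 0 t)) := by
      rw [F, ← Real.exp_add]; congr 1; ring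
    have e2 : Real.exp (4 / 3 * (v 0 t - u 0 t)) ≤ Real.exp (4 / 3 * D) :=
      Real.exp_le_exp.mpr (by linarith [hd 0 t (by linarith) h1])
    rw [e1]
    calc _ ≤ 4 * (T - t) * Real.exp (4 / 3 * D) :=
          mul_le_mul (hw t h0 h1) e2 (Real.exp_pos _).le (by linarith)
      _ = _ := by ring
  set C := 4 * Real.exp (4 / 3 * D) with hC
  have hCp : 0 < C := by positivity
  set b0 := Real.exp (-(2 / 3) * D) with hb0
  have hb0p : 0 < b0 := by positivity
  -- time after which F_t ≤ -b0
  set t2 := max ((t1 + T) / 2) (T - b0 / (CR * C)) with ht2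
  have h2a : (t1 + T) / 2 ≤ t2 := le_max_left _ _
  have h2b : T - b0 / (CR * C) ≤ t2 := le_max_right _ _
  have h2T : t2 < T := max_lt (by linarith) (by linarith [div_pos hb0p (mul_pos hCR hCp)])
  have hF1 : ∀ t, t2 ≤ t → t < T → b0 * (T - t) ≤ F u v 0 t := by
    have hder : ∀ t, t2 ≤ t → t < T → HasDerivAt (fun t => F u v 0 t + b0 * t)
        ((2 / 3) * (p1 0 t + 2 * c1 0 t + (p 0 t + 2 * c 0 t) ^ 2
        - 8 * y 0 t + 2 * q 0 t) * F u v 0 t + b0) t := by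
      intro t h0 h1
      have := (h.hF.add (J_time.cmul b0)).t 0 t (by linarith) h1
      simpa using this
    have hanti : AntitoneOn (fun t => F u v 0 t + b0 * t) (Set.Ico t2 T) := by
      refine antitoneOn_of_deriv_nonpos (convex_Ico _ _)
        (fun t ht => (hder t ht.1 ht.2).continuousAt.continuousWithinAt) ?_ ?_
      · rw [interior_Ico]
        exact fun t ht => (hder t ht.1.le ht.2).differentiableAt.differentiableWithinAt
      · rw [interior_Ico]
        intro t ht
        have htp : 0 < t := by linarith [ht.1]
        rw [(hder t ht.1.le ht.2).deriv, p0 t htp ht.2, c0 t htp ht.2]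
        have r1 := hR 0 t (by linarith [ht.1]) ht.2
        rw [p0 t htp ht.2, c0 t htp ht.2] at r1
        have r2 := h.q_le_y 0 t htp ht.2
        have hFp : 0 < F u v 0 t := F_pos 0 t
        have r3 : b0 ≤ F u v 0 t * y 0 t := by
          rw [h.Fy]
          exact Real.exp_le_exp.mpr (by linarith [hd 0 t (by linarith [ht.1]) ht.2])
        have r4 : CR * F u v 0 t ≤ b0 := by
          have r5 := hF0 t (by linarith [ht.1]) ht.2
          have r6 : T - t ≤ b0 / (CR * C) := by linarith [ht.1]
          rw [le_div_iff₀ (mul_pos hCR hCp)] at r6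
          have := mul_le_mul_of_nonneg_left r5 hCR.le
          linarith
        have r7 : p1 0 t + 2 * c1 0 t + (0 + 2 * 0) ^ 2 - 8 * y 0 t + 2 * q 0 t
            ≤ -3 * y 0 t + CR := by linarith
        have r8 := mul_le_mul_of_nonneg_right r7 hFp.le
        linarith
    intro t h0 h1
    by_contra hcon
    push Not at hcon
    -- pick s close to T
    set s := max t (T - (b0 * (T - t) - F u v 0 t) / (2 * b0)) with hs
    have hs1 : t ≤ s := le_max_left _ _
    have hx1 : 0 < b0 * (T - t) - F u v 0 t := by linarith
    have hx2 : 0 < 2 * b0 := by linarith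
    have hx3 := div_pos hx1 hx2
    have hs2 : s < T := max_lt h1 (by linarith)
    have hs3 : T - s ≤ (b0 * (T - t) - F u v 0 t) / (2 * b0) := by
      linarith [le_max_right t (T - (b0 * (T - t) - F u v 0 t) / (2 * b0))]
    rw [le_div_iff₀ (by linarith)] at hs3
    have h3 := hanti ⟨h0, h1⟩ ⟨by linarith, hs2⟩ hs1
    simp only at h3
    have h4 : 0 < F u v 0 s := F_pos 0 s
    nlinarith
  refine ⟨Real.exp (-(4 / 3) * D) * b0, C, t2, by positivity, ?_, hCp, by linarith, h2T, ?_, ?_⟩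
  · rw [hb0, ← Real.exp_add]
    exact Real.exp_le_one_iff.mpr (by linarith)
  · intro ξ t h0 h1
    have htp : 0 < t := by linarith
    have e1 : Real.exp (2 * u 0 t) ≤ F u v ξ t :=
      Real.exp_le_exp.mpr (by linarith [h.ord ξ t htp h1, hmin ξ t (by linarith) h1])
    have e2 : Real.exp (-(4 / 3) * D) * F u v 0 t ≤ Real.exp (2 * u 0 t) := by
      rw [F, ← Real.exp_add]
      exact Real.exp_le_exp.mpr (by linarith [hd 0 t (by linarith) h1])
    have e3 := mul_le_mul_of_nonneg_left (hF1 t h0 h1) (Real.exp_pos (-(4 / 3) * D)).le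
    linarith
  · intro t h0 h1
    exact hF0 t (by linarith) h1

lemma psi_bd (h : Sys T ρ u v p c p1 c1 p2 c2 p3 c3 q y)
    (hρ : ∀ t, 0 < t → t < T → Continuous (fun x => ρ x t)) : ∃ L : ℝ, 0 < L ∧
    ∀ ξ t, T / 2 ≤ t → t < T → Real.exp ((u ξ t + 2 * v ξ t) / 3)
      ≤ Real.exp ((u 0 t + 2 * v 0 t) / 3) + L * |arcS ρ ξ t| := by
  obtain ⟨K, hK, hmu⟩ := h.mu_bd
  obtain ⟨V, hV, hFV⟩ := h.F_upper
  have hT := h.T_pos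
  refine ⟨1 + K * V, by positivity, ?_⟩
  set L := 1 + K * V with hL
  have hLp : 1 ≤ L := by rw [hL]; linarith [mul_pos hK hV]
  intro ξ t ht hT1
  have htp : 0 < t := by linarith
  have jpsi : J T ρ (fun x t => Real.exp ((u x t + 2 * v x t) / 3))
      (fun x t => (p x t + 2 * c x t) / 3 * Real.exp ((u x t + 2 * v x t) / 3))
      (pdt (fun x t => Real.exp ((u x t + 2 * v x t) / 3))) := by
    refine ((((h.hu.add (h.hv.cmul 2)).cmul (1 / 3))).exp).of_eqs ?_ ?_ <;> intros <;> ring_nf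
  set ψ : ℝ → ℝ := fun x => Real.exp ((u x t + 2 * v x t) / 3) with hψ
  have hdψ : ∀ x, HasDerivAt ψ (ρ x t * ((p x t + 2 * c x t) / 3 * ψ x)) x :=
    fun x => jpsi.s x t htp hT1
  have hbd : ∀ x, |(p x t + 2 * c x t) / 3 * ψ x| ≤ L := by
    intro x
    have e1 : ψ x ^ 2 = F u v x t := by
      rw [F, hψ, ← Real.exp_nat_mul]; congr 1; push_cast; ring
    have e2 := hmu t ht hT1 0 le_rfl (fun ξ => (F_pos ξ t).le) x
    rw [zero_div, sub_zero] at e2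
    have e3 : ((p x t + 2 * c x t) / 3 * ψ x) ^ 2 ≤ L := by
      have := mul_le_mul_of_nonneg_left (hFV x t ht hT1) hK.le
      calc ((p x t + 2 * c x t) / 3 * ψ x) ^ 2 = (p x t + 2 * c x t) ^ 2 / 9 * F u v x t := by
            rw [← e1]; ring
        _ ≤ L := by rw [hL]; linarith
    refine abs_le_of_sq_le_sq ?_ (by linarith)
    nlinarith
  have hρc : Continuous (fun x => ρ x t) := hρ t htp hT1
  have hdS : ∀ x, HasDerivAt (fun x => arcS ρ x t) (ρ x t) x := by
    intro x
    exact intervalIntegral.integral_hasDerivAt_right (hρc.intervalIntegrable _ _)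
      (hρc.stronglyMeasurableAtFilter _ _) hρc.continuousAt
  have hS0 : arcS ρ 0 t = 0 := by simp [arcS]
  rcases le_total 0 ξ with hx | hx
  · have ha : Antitone (fun x => ψ x - L * arcS ρ x t) := by
      have hder : ∀ x, HasDerivAt (fun x => ψ x - L * arcS ρ x t)
          (ρ x t * ((p x t + 2 * c x t) / 3 * ψ x) - L * ρ x t) x :=
        fun x => (hdψ x).sub ((hdS x).const_mul L)
      refine antitone_of_deriv_nonpos (fun x => (hder x).differentiableAt) ?_
      intro x
      rw [(hder x).deriv]
      have := (abs_le.mp (hbd x)).2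
      nlinarith [h.ρ_pos x t htp hT1]
    have := ha hx
    simp only [hS0] at this
    have h3 := mul_le_mul_of_nonneg_left (le_abs_self (arcS ρ ξ t)) (by linarith : 0 ≤ L)
    change ψ ξ ≤ ψ 0 + _
    linarith
  · have ha : Monotone (fun x => ψ x + L * arcS ρ x t) := by
      have hder : ∀ x, HasDerivAt (fun x => ψ x + L * arcS ρ x t)
          (ρ x t * ((p x t + 2 * c x t) / 3 * ψ x) + L * ρ x t) x :=
        fun x => (hdψ x).add ((hdS x).const_mul L)
      refine monotone_of_deriv_nonneg (fun x => (hder x).differentiableAt) ?_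
      intro x
      rw [(hder x).deriv]
      have := (abs_le.mp (hbd x)).1
      nlinarith [h.ρ_pos x t htp hT1]
    have := ha hx
    simp only [hS0] at this
    have h3 := mul_le_mul_of_nonneg_left (neg_le_abs (arcS ρ ξ t)) (by linarith : 0 ≤ L)
    change ψ ξ ≤ ψ 0 + _
    linarith

end Sys
/-- Under Assumption C, for every sufficiently small `δ > 0` and every
`Σ < ∞` there exist `C < ∞` and `T_* < T` such that for all `t ∈ (T_*,T)` and all `ξ` in
the parabolic region `|S(ξ,t)| ≤ Σ√(T−t)` around the neck, one has
`(g − f)/√(T−t) ≤ C(T−t)^{1+δ}`. -/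
theorem reflection_symmetric_decay (T : ℝ) (f g ρ : ℝ → ℝ → ℝ)
    (sol : AssumptionC T f g ρ) :
    ∃ δ₀ : ℝ, 0 < δ₀ ∧ ∀ δ : ℝ, 0 < δ → δ < δ₀ → ∀ Sig : ℝ,
      ∃ C Tstar : ℝ, Tstar < T ∧
        ∀ ξ t : ℝ, -π < ξ → ξ ≤ π → Tstar < t → t < T →
          |arcS ρ ξ t| ≤ Sig * Real.sqrt (T - t) →
          (g ξ t - f ξ t) / Real.sqrt (T - t) ≤ C * (T - t) ^ ((1:ℝ) + δ) := by
  obtain ⟨p, c, p1, c1, p2, c2, p3, c3, q, y, h, hk⟩ := sol.sys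
  have hT := sol.T_pos
  obtain ⟨t₁, ht₁, ht₁T, hcen⟩ := sol.min_at_center
  have fpos : ∀ ξ t : ℝ, 0 < t → t < T → 0 < f ξ t := fun ξ t h0 h1 => sol.f_pos ξ t h0.le h1
  have gpos : ∀ ξ t : ℝ, 0 < t → t < T → 0 < g ξ t := fun ξ t h0 h1 => sol.g_pos ξ t h0.le h1
  have hfg : ∀ ξ t : ℝ, 0 < t → t < T → f ξ t ≤ g ξ t := fun ξ t h0 h1 =>
    (Real.log_le_log_iff (fpos ξ t h0 h1) (gpos ξ t h0 h1)).1 (h.ord ξ t h0 h1)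
  have hρ : ∀ t : ℝ, 0 < t → t < T → Continuous (fun x => ρ x t) := by
    intro t h0 h1
    have hc1 : ContinuousOn (fun p : ℝ × ℝ => ρ p.1 p.2) (Set.univ ×ˢ Set.Ico 0 T) :=
      (ContDiffOn.snd (ContDiffOn.snd sol.smooth)).continuousOn
    exact hc1.comp_continuous (f := fun x : ℝ => (x, t)) (by fun_prop)
      (fun x => ⟨Set.mem_univ _, h0.le, h1⟩)
  have hblow : ∀ U t2 : ℝ, 0 < t2 → t2 < T →
      ¬ ∀ ξ t, t2 ≤ t → t < T → -U ≤ (fun x t => Real.log (f x t)) ξ t := by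
    intro U t2 h0 h1 hU
    obtain ⟨K, hK, hb⟩ := h.curv_bd h0 h1 hU
    obtain ⟨ξ, t, ht, htT, hbig⟩ := sol.ricci_blowup (100 * (K + 1)) t2 h0.le h1
    have htp : 0 < t := h0.trans ht
    obtain ⟨e1, e2, e3, e4⟩ := hk ξ t htp htT
    obtain ⟨b1, b2, b3⟩ := hb ξ t ht.le htT
    have hq := h.q_pos ξ t
    have hqy := h.q_le_y ξ t htp htT
    rw [e1, e2, e3, e4] at hbig
    generalize p ξ t = P at *
    generalize c ξ t = Q at *
    generalize p1 ξ t = P1 at *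
    generalize c1 ξ t = Q1 at *
    have a1 : |P1| ≤ K + 1 := abs_le.2 ⟨by nlinarith, by nlinarith⟩
    have a2 : |Q1| ≤ K + 1 := abs_le.2 ⟨by nlinarith, by nlinarith⟩
    have a3 : |P * Q| ≤ K + 1 := abs_le.2
      ⟨by nlinarith [sq_nonneg (P + Q)], by nlinarith [sq_nonneg (P - Q)]⟩
    have a4 : P ^ 2 ≤ K := by nlinarith
    have a5 : Q ^ 2 ≤ K := by nlinarith
    have a6 := sq_nonneg P
    have a7 := sq_nonneg Q
    rw [abs_le] at a1 a2 a3
    have r1 : |-(P1 + P ^ 2) + 2 * (q ξ t - P * Q)| ≤ 20 * (K + 1) :=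
      abs_le.2 ⟨by linarith, by linarith⟩
    have r2 : |-(P1 + P ^ 2) + 2 * -(Q1 + Q ^ 2)| ≤ 20 * (K + 1) :=
      abs_le.2 ⟨by linarith, by linarith⟩
    have r3 : |-(Q1 + Q ^ 2) + (q ξ t - P * Q) + (4 * y ξ t - 3 * q ξ t - Q ^ 2)|
        ≤ 20 * (K + 1) := abs_le.2 ⟨by linarith, by linarith⟩
    linarith
  obtain ⟨b, C, t2, hb0, hb1, hC, ht2, ht2T, hlow, hneck⟩ :=
    h.neck (t1 := max t₁ (T / 2)) (le_max_right _ _) (max_lt ht₁T (by linarith))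
      (by
        intro ξ t h0 h1
        have h2 : t₁ < t := lt_of_le_of_lt (le_max_left _ _) h0
        have htp : 0 < t := lt_of_le_of_lt ht₁ h2
        have h3 := hcen t h2 h1
        have h4 : Mcheck f g t ≤ M f g ξ t := by
          refine ciInf_le ⟨0, ?_⟩ ξ
          rintro _ ⟨x, rfl⟩
          exact le_min (fpos x t htp h1).le (gpos x t htp h1).le
        rw [← h3, M, M, min_eq_left (hfg 0 t htp h1), min_eq_left (hfg ξ t htp h1)] at h4
        exact Real.log_le_log (fpos 0 t htp h1) h4)
      (by intro ξ t; simp only [sol.refl_f])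
      (by intro ξ t; simp only [sol.refl_g]) hblow
  obtain ⟨L, hL, hψ⟩ := h.psi_bd hρ
  obtain ⟨D, hD, hd⟩ := h.d_upper
  refine ⟨b / 52, by positivity, ?_⟩
  intro δ hδ hδb Sig
  obtain ⟨A, hA, hfin⟩ := h.final_bd hb0 hb1 ht2 ht2T hlow hδ hδb.le
  set Mc : ℝ := Real.sqrt C + L * |Sig| with hMc
  have hMc0 : 0 ≤ Mc := by positivity
  refine ⟨A * Real.exp (D / 3) * Mc * Mc ^ (2 + 2 * δ), t2, ht2T, ?_⟩
  intro ξ t _ _ ht htT hS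
  have hτ : 0 < T - t := by linarith
  have hsq : 0 < Real.sqrt (T - t) := Real.sqrt_pos.2 hτ
  have htp : 0 < t := by linarith
  rw [div_le_iff₀ hsq]
  have e0 := hψ ξ t (by linarith) htT
  have e1 := hfin ξ t ht.le htT
  have e2 := hd ξ t (by linarith) htT
  have e3 := hneck t ht.le htT
  have hf := fpos ξ t htp htT
  have hg := gpos ξ t htp htT
  have hle := hfg ξ t htp htT
  have hfe := Real.exp_log hf
  have hge := Real.exp_log hg
  have hord := h.ord ξ t htp htT
  beta_reduce at e0 e1 e2 hord
  simp only [Sys.F] at e3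
  generalize Real.log (f ξ t) = U at *
  generalize Real.log (g ξ t) = V at *
  generalize Real.log (f 0 t) = U0 at *
  generalize Real.log (g 0 t) = V0 at *
  have z1 : Real.exp ((U0 + 2 * V0) / 3) ≤ Real.sqrt C * Real.sqrt (T - t) := by
    rw [← Real.sqrt_mul hC.le]
    apply Real.le_sqrt_of_sq_le
    rw [← Real.exp_nat_mul]
    refine le_trans (le_of_eq ?_) e3
    congr 1
    push_cast
    ring
  have z2 : L * |arcS ρ ξ t| ≤ L * |Sig| * Real.sqrt (T - t) := by
    rw [mul_assoc]
    refine mul_le_mul_of_nonneg_left (hS.trans ?_) hL.le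
    exact mul_le_mul_of_nonneg_right (le_abs_self _) hsq.le
  set ψ := Real.exp ((U + 2 * V) / 3) with hψdef
  have hψ0 : 0 < ψ := Real.exp_pos _
  have z3 : ψ ≤ Mc * Real.sqrt (T - t) := by
    rw [hMc, add_mul]; linarith
  have z4 : Real.exp ((2 + 2 * δ) / 3 * (U + 2 * V)) = ψ ^ (2 + 2 * δ) := by
    rw [hψdef, ← Real.exp_mul]; congr 1; ring
  have z5 : (Real.sqrt (T - t)) ^ (2 + 2 * δ) = (T - t) ^ (1 + δ) := by
    rw [Real.sqrt_eq_rpow, ← Real.rpow_mul hτ.le]; congr 1; ring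
  have z6 : ψ ^ (2 + 2 * δ) ≤ Mc ^ (2 + 2 * δ) * (T - t) ^ (1 + δ) := by
    rw [← z5, ← Real.mul_rpow hMc0 hsq.le]
    exact Real.rpow_le_rpow hψ0.le z3 (by linarith)
  have z7 : g ξ t - f ξ t ≤ Real.exp V * (V - U) := by
    rw [← hfe, ← hge]
    have s1 := Real.add_one_le_exp (U - V)
    have s2 : Real.exp U = Real.exp V * Real.exp (U - V) := by
      rw [← Real.exp_add]; congr 1; ring
    rw [s2]
    nlinarith [Real.exp_pos V]
  have z8 : Real.exp V ≤ Mc * Real.sqrt (T - t) * Real.exp (D / 3) := by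
    have s1 : Real.exp V = ψ * Real.exp ((V - U) / 3) := by
      rw [hψdef, ← Real.exp_add]; congr 1; ring
    rw [s1]
    exact mul_le_mul z3 (Real.exp_le_exp.2 (by linarith)) (Real.exp_pos _).le (by positivity)
  have z9 : V - U ≤ A * (Mc ^ (2 + 2 * δ) * (T - t) ^ (1 + δ)) := by
    rw [z4] at e1
    exact e1.trans (mul_le_mul_of_nonneg_left z6 hA.le)
  calc g ξ t - f ξ t ≤ Real.exp V * (V - U) := z7
    _ ≤ (Mc * Real.sqrt (T - t) * Real.exp (D / 3)) * (A * (Mc ^ (2 + 2 * δ) * (T - t) ^ (1 + δ))) :=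
        mul_le_mul z8 z9 (by linarith) (by positivity)
    _ = _ := by ring
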